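/- arXiv:2401.04510 — 11 statements merged into one kernel-verified Lean document; each statement's English description precedes it below -/
import Mathlib

section
/- For every integer a and every choice of ε, ε' ∈ {1, −1}, the polynomial f_a(X) = X³ + aX² − (a + ε + ε' + 1)X + ε is irreducible in ℚ[X]. -/
open Polynomial

/-- An integral cubic `X³ + aX² + bX + c` with `c` and `1 + a + b + c` both odd has no
rational root, since it has no root modulo `2`. -/
lemma cubic_eval_ne_zero_of_odd {a b c : ℤ} (h0 : Odd c) (h1 : Odd (1 + a + b + c)) (x : ℚ) :
    x ^ 3 + a * x ^ 2 + b * x + c ≠ 0 := by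
  intro hx
  have hmonic : (X ^ 3 + C a * X ^ 2 + C b * X + C c : ℤ[X]).Monic := by monicity!
  obtain ⟨n, rfl⟩ := isInteger_of_is_root_of_monic (K := ℚ) hmonic (r := x) (by simpa using hx)
  have hn : n ^ 3 + a * n ^ 2 + b * n + c = 0 := by
    simp only [algebraMap_int_eq, eq_intCast] at hx
    exact_mod_cast hx
  have heven : Even (n ^ 3 + a * n ^ 2 + b * n + c) := hn ▸ Even.zero
  simp only [← Int.not_even_iff_odd, Int.even_add, Int.even_mul, Int.even_pow,
    Int.not_even_one] at h0 h1 heven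
  by_cases h : Even n <;> simp [h, -Int.not_even_iff_odd] at h1 heven <;> tauto

/-- For every integer `a` and every choice of `ε, ε' ∈ {1, -1}`, the polynomial
`f_a(X) = X³ + aX² − (a + ε + ε' + 1)X + ε` is irreducible in `ℚ[X]`. -/
theorem cubic_family_irreducible (a ε ε' : ℤ) (hε : ε = 1 ∨ ε = -1) (hε' : ε' = 1 ∨ ε' = -1) :
    Irreducible (X ^ 3 + C (a : ℚ) * X ^ 2 - C ((a : ℚ) + (ε : ℚ) + (ε' : ℚ) + 1) * X
      + C (ε : ℚ)) := by
  have hdeg : (X ^ 3 + C (a : ℚ) * X ^ 2 - C ((a : ℚ) + (ε : ℚ) + (ε' : ℚ) + 1) * X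
      + C (ε : ℚ)).natDegree = 3 := by compute_degree!
  refine irreducible_of_degree_le_three_of_not_isRoot (by rw [hdeg]; decide) fun x hx => ?_
  have hodd : Odd ε := by rcases hε with rfl | rfl <;> decide
  have hodd' : Odd (1 + a + -(a + ε + ε' + 1) + ε) := by
    rw [show 1 + a + -(a + ε + ε' + 1) + ε = -ε' by ring]
    rcases hε' with rfl | rfl <;> decide
  refine cubic_eval_ne_zero_of_odd hodd hodd' x ?_
  simp only [IsRoot, eval_add, eval_sub, eval_mul, eval_pow, eval_X, eval_C] at hx
  push_cast
  linear_combination hx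
end

section
/- Let a be an integer, ε, ε' ∈ {1, −1}, and let u be a root (in an algebraic closure of ℚ) of f_a(X) = X³ + aX² − (a + ε + ε' + 1)X + ε. Then the field F = ℚ(u) has degree 3 over ℚ, and both u and 1 − u are units of the ring of integers of F; that is, u, u⁻¹, 1 − u and (1 − u)⁻¹ are all integral over ℤ. -/
open IntermediateField

/-- A root of a monic cubic with integer coefficients is integral over `ℤ`. -/
theorem isIntegral_of_monic_cubic {R : Type*} [CommRing R] (b c d : ℤ) (x : R)
    (hx : x ^ 3 + (b : R) * x ^ 2 + (c : R) * x + (d : R) = 0) : IsIntegral ℤ x := by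
  refine ⟨Polynomial.X ^ 3 + Polynomial.C b * Polynomial.X ^ 2 + Polynomial.C c * Polynomial.X
    + Polynomial.C d, by monicity!, ?_⟩
  simpa only [Polynomial.eval₂_add, Polynomial.eval₂_mul, Polynomial.eval₂_pow, Polynomial.eval₂_C,
    Polynomial.eval₂_X, algebraMap_int_eq, Int.coe_castRingHom] using hx

/-- A monic integer cubic taking odd values at `0` and `1` has no rational root. -/
theorem monic_cubic_ne_zero_of_odd (b c d : ℤ) (hd : Odd d)
    (hbcd : Odd (1 + b + c + d)) (r : ℚ) :
    r ^ 3 + (b : ℚ) * r ^ 2 + (c : ℚ) * r + (d : ℚ) ≠ 0 := by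
  intro hr
  obtain ⟨n, rfl⟩ := IsIntegrallyClosed.isIntegral_iff.mp (isIntegral_of_monic_cubic b c d r hr)
  have hn : n ^ 3 + b * n ^ 2 + c * n + d = 0 := by
    rw [eq_intCast] at hr
    exact_mod_cast hr
  have hodd : ¬ Even (n ^ 3 + b * n ^ 2 + c * n + d) := by
    rw [← Int.not_even_iff_odd] at hd hbcd
    simp only [Int.even_add, Int.even_mul, Int.even_pow, Int.not_even_one] at hbcd ⊢
    tauto
  exact hodd (hn ▸ Even.zero)

/-- A root of a monic integer cubic taking odd values at `0` and `1` has degree `3` over `ℚ`. -/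
theorem finrank_adjoin_root_monic_cubic_of_odd {L : Type*} [Field L] [Algebra ℚ L]
    (b c d : ℤ) (hd : Odd d) (hbcd : Odd (1 + b + c + d)) (x : L)
    (hx : x ^ 3 + (b : L) * x ^ 2 + (c : L) * x + (d : L) = 0) :
    Module.finrank ℚ ℚ⟮x⟯ = 3 := by
  let p : Polynomial ℚ := Polynomial.X ^ 3 + Polynomial.C (b : ℚ) * Polynomial.X ^ 2
    + Polynomial.C (c : ℚ) * Polynomial.X + Polynomial.C (d : ℚ)
  have hdeg : p.natDegree = 3 := by unfold p; compute_degree!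
  have hmonic : p.Monic := by unfold p; monicity!
  have hirr : Irreducible p := by
    rw [Polynomial.irreducible_iff_roots_eq_zero_of_degree_le_three (by lia) (by lia),
      Multiset.eq_zero_iff_forall_notMem]
    intro r hr
    refine monic_cubic_ne_zero_of_odd b c d hd hbcd r ?_
    simpa [p] using Polynomial.isRoot_of_mem_roots hr
  have hroot : Polynomial.aeval x p = 0 := by simpa [p] using hx
  rw [adjoin.finrank ⟨p, hmonic, hroot⟩, ← minpoly.eq_of_irreducible_of_monic hirr hroot hmonic,
    hdeg]

/-- Let `u` be a root, in an algebraic closure of `ℚ`, of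
`f_a(X) = X³ + aX² − (a + ε + ε' + 1)X + ε` with `a ∈ ℤ` and `ε, ε' ∈ {1, -1}`.
Then `F = ℚ(u)` has degree `3` over `ℚ`, and both `u` and `1 - u` are units of the
ring of integers of `F`; that is, `u`, `u⁻¹`, `1 - u` and `(1 - u)⁻¹` are all
integral over `ℤ`. -/
theorem cubic_family_root_exceptional_unit (a ε ε' : ℤ)
    (hε : ε = 1 ∨ ε = -1) (hε' : ε' = 1 ∨ ε' = -1) (u : AlgebraicClosure ℚ)
    (hu : u ^ 3 + (a : AlgebraicClosure ℚ) * u ^ 2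
      - ((a : AlgebraicClosure ℚ) + (ε : AlgebraicClosure ℚ) + (ε' : AlgebraicClosure ℚ) + 1) * u
      + (ε : AlgebraicClosure ℚ) = 0) :
    Module.finrank ℚ (ℚ⟮u⟯ : IntermediateField ℚ (AlgebraicClosure ℚ)) = 3 ∧
      IsIntegral ℤ u ∧ IsIntegral ℤ u⁻¹ ∧ IsIntegral ℤ (1 - u) ∧ IsIntegral ℤ (1 - u)⁻¹ := by
  have hε2 : (ε : AlgebraicClosure ℚ) ^ 2 = 1 := by rcases hε with rfl | rfl <;> norm_num
  have hε'2 : (ε' : AlgebraicClosure ℚ) ^ 2 = 1 := by rcases hε' with rfl | rfl <;> norm_num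
  have hcubic : u ^ 3 + (a : AlgebraicClosure ℚ) * u ^ 2
      + ((-(a + ε + ε' + 1) : ℤ) : AlgebraicClosure ℚ) * u + (ε : AlgebraicClosure ℚ) = 0 := by
    push_cast
    linear_combination hu
  have hint : IsIntegral ℤ u := isIntegral_of_monic_cubic _ _ _ u hcubic
  have hcast (n : ℤ) : IsIntegral ℤ (n : AlgebraicClosure ℚ) := isIntegral_algebraMap
  have hinv : u⁻¹ = ((-ε : ℤ) : AlgebraicClosure ℚ)
      * (u ^ 2 + (a : AlgebraicClosure ℚ) * u - ((a + ε + ε' + 1 : ℤ) : AlgebraicClosure ℚ)) := by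
    apply inv_eq_of_mul_eq_one_right
    push_cast
    linear_combination (-(ε : AlgebraicClosure ℚ)) * hu + hε2
  have hinv' : (1 - u)⁻¹ = ((-ε' : ℤ) : AlgebraicClosure ℚ)
      * (u ^ 2 + ((a + 1 : ℤ) : AlgebraicClosure ℚ) * u
        - ((ε + ε' : ℤ) : AlgebraicClosure ℚ)) := by
    apply inv_eq_of_mul_eq_one_right
    push_cast
    linear_combination (ε' : AlgebraicClosure ℚ) * hu + hε'2
  refine ⟨finrank_adjoin_root_monic_cubic_of_odd _ _ _ ?_ ?_ u hcubic, hint, ?_,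
    isIntegral_one.sub hint, ?_⟩
  · rcases hε with rfl | rfl <;> decide
  · rw [show 1 + a + -(a + ε + ε' + 1) + ε = -ε' by ring]
    rcases hε' with rfl | rfl <;> decide
  · rw [hinv]
    exact (hcast _).mul (((hint.pow 2).add ((hcast _).mul hint)).sub (hcast _))
  · rw [hinv']
    exact (hcast _).mul (((hint.pow 2).add ((hcast _).mul hint)).sub (hcast _))
end

section
/- Let F be a number field with [F : ℚ] = 3 and let u ∈ F be such that ℚ(u) = F and both u and 1 − u are units of the ring of integers of F. Then the minimal polynomial of u over ℚ is equal to X³ + aX² − (a + ε + ε' + 1)X + ε for some integer a and some ε, ε' ∈ {1, −1}. -/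
open Polynomial IntermediateField

/-- The constant coefficient of the minimal polynomial of an algebraic unit is `1` or `-1`. -/
theorem abs_coeff_zero_minpoly_of_unit {F : Type*} [Field F] [NumberField F]
    (w : (integralClosure ℤ F)ˣ) :
    |(minpoly ℚ ((w : integralClosure ℤ F) : F)).coeff 0| = 1 := by
  set x : F := ((w : integralClosure ℤ F) : F)
  have hnorm : |Algebra.norm ℚ x| = 1 :=
    NumberField.Units.norm F (w : (NumberField.RingOfIntegers F)ˣ)
  have hint : IsIntegral ℚ x := IsIntegral.of_finite ℚ x
  rw [Algebra.norm_eq_norm_adjoin, abs_pow,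
    pow_eq_one_iff_of_nonneg (abs_nonneg _) Module.finrank_pos.ne'] at hnorm
  have hgen := Algebra.PowerBasis.norm_gen_eq_coeff_zero_minpoly (adjoin.powerBasis hint)
  rw [adjoin.powerBasis_gen, minpoly_gen] at hgen
  rwa [hgen, abs_mul, abs_pow, abs_neg, abs_one, one_pow, one_mul] at hnorm

/-- Let `F` be a number field of degree `3` over `ℚ` and let `u ∈ F` be such that
`ℚ(u) = F` and both `u` and `1 - u` are units of the ring of integers of `F` (the
integral closure of `ℤ` in `F`). Then the minimal polynomial of `u` over `ℚ` equals
`X³ + aX² − (a + ε + ε' + 1)X + ε` for some integer `a` and some `ε, ε' ∈ {1, -1}`. -/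
theorem cubic_field_exceptional_unit_minpoly (F : Type*) [Field F] [NumberField F]
    (hdeg : Module.finrank ℚ F = 3) (u : F) (hgen : ℚ⟮u⟯ = (⊤ : IntermediateField ℚ F))
    (hu : ∃ w : (integralClosure ℤ F)ˣ, ((w : integralClosure ℤ F) : F) = u)
    (hu' : ∃ w : (integralClosure ℤ F)ˣ, ((w : integralClosure ℤ F) : F) = 1 - u) :
    ∃ (a ε ε' : ℤ), (ε = 1 ∨ ε = -1) ∧ (ε' = 1 ∨ ε' = -1) ∧
      minpoly ℚ u = X ^ 3 + C (a : ℚ) * X ^ 2 - C ((a : ℚ) + (ε : ℚ) + (ε' : ℚ) + 1) * X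
        + C (ε : ℚ) := by
  obtain ⟨w, hw⟩ := hu
  obtain ⟨w', hw'⟩ := hu'
  have hint : IsIntegral ℤ u := hw ▸ (w : integralClosure ℤ F).2
  have hintQ : IsIntegral ℚ u := IsIntegral.of_finite ℚ u
  have hnat : (minpoly ℚ u).natDegree = 3 := by
    rw [← adjoin.finrank hintQ, hgen, finrank_top', hdeg]
  have hzero := abs_coeff_zero_minpoly_of_unit w
  have hone := abs_coeff_zero_minpoly_of_unit w'
  rw [hw] at hzero
  have hsub : 1 - u = -(u - algebraMap ℚ F 1) := by simp
  rw [hw', hsub, minpoly.neg, minpoly.sub_algebraMap, coeff_zero_eq_eval_zero] at hone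
  simp only [eval_mul, eval_comp, eval_neg, eval_X, eval_add, eval_C, neg_zero, zero_add,
    eval_pow, eval_one, abs_mul, abs_pow, abs_neg, abs_one, one_pow, one_mul] at hone
  have hmap := minpoly.isIntegrallyClosed_eq_field_fractions' ℚ hint
  have hlead : (minpoly ℚ u).coeff 3 = 1 := hnat ▸ (minpoly.monic hintQ).coeff_natDegree
  have hpoly := (minpoly ℚ u).as_sum_range_C_mul_X_pow
  rw [hnat] at hpoly
  simp only [Finset.sum_range_succ, Finset.sum_range_zero, hlead] at hpoly
  have hcoeff (n : ℕ) : (minpoly ℚ u).coeff n = ((minpoly ℤ u).coeff n : ℚ) := by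
    rw [hmap, coeff_map, eq_intCast]
  simp only [hcoeff] at hpoly hzero
  generalize (minpoly ℤ u).coeff 0 = c at *
  generalize (minpoly ℤ u).coeff 1 = b at *
  generalize (minpoly ℤ u).coeff 2 = a at *
  rw [hpoly] at hone
  simp only [eval_add, eval_mul, eval_C, eval_pow, eval_X, one_pow, mul_one, zero_add] at hone
  refine ⟨a, c, -(c + b + a + 1), ?_, ?_, ?_⟩
  · exact eq_or_eq_neg_of_abs_eq (by exact_mod_cast hzero)
  · refine eq_or_eq_neg_of_abs_eq ?_
    rw [abs_neg]
    exact_mod_cast hone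
  · rw [hpoly]
    push_cast
    simp only [map_add, map_neg, map_one]
    ring
end

section
/- Let a be an integer and ε, ε' ∈ {1, −1}, and let f_a(X) = X³ + aX² − (a + ε + ε' + 1)X + ε. The splitting field of f_a over ℚ has degree 3 over ℚ (equivalently, its Galois group is cyclic of order 3) if and only if ε = ε' = 1 or |2a − ε + ε' + 3| = 7. -/
open Polynomial

/-- Two roots of a separable cubic are rational functions of the third one and of a square root of
the discriminant. -/
theorem Cubic.mem_of_roots_of_sqrt_discr {F K : Type*} [Field F] [CharZero F] [Field K]
    [Algebra F K] {P : Cubic F} (ha : P.a ≠ 0) (hd : P.discr ≠ 0) {x y z : K}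
    (h3 : (P.map (algebraMap F K)).roots = {x, y, z}) {E : IntermediateField F K} (hx : x ∈ E)
    {s : F} (hs : algebraMap F K P.a * algebraMap F K P.a * (x - y) * (x - z) * (y - z) =
      algebraMap F K s) : y ∈ E ∧ z ∈ E := by
  have : CharZero K := charZero_of_injective_algebraMap (algebraMap F K).injective
  obtain ⟨hxy, hxz, -⟩ := (Cubic.discr_ne_zero_iff_roots_ne ha h3).1 hd
  have ha' : algebraMap F K P.a ≠ 0 := (_root_.map_ne_zero _).2 ha
  have hb := Cubic.b_eq_three_roots ha h3
  have hc := Cubic.c_eq_three_roots ha h3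
  have hsum : y + z = -(algebraMap F K (P.b / P.a)) - x := by
    rw [map_div₀, hb]
    field_simp
    ring
  have hder : algebraMap F K P.a * (x - y) * (x - z) =
      algebraMap F K (3 * P.a) * x ^ 2 + algebraMap F K (2 * P.b) * x + algebraMap F K P.c := by
    simp only [map_mul, map_ofNat, hb, hc]
    ring
  have hdiff : y - z = algebraMap F K s / (algebraMap F K P.a * (algebraMap F K (3 * P.a) * x ^ 2 +
      algebraMap F K (2 * P.b) * x + algebraMap F K P.c)) := by
    rw [← hder, ← hs]
    have := sub_ne_zero.2 hxy
    have := sub_ne_zero.2 hxz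
    field_simp
  have hsumE : y + z ∈ E := by
    rw [hsum]
    exact sub_mem (neg_mem (E.algebraMap_mem _)) hx
  have hdiffE : y - z ∈ E := by
    rw [hdiff]
    exact div_mem (E.algebraMap_mem _) (mul_mem (E.algebraMap_mem _)
      (add_mem (add_mem (mul_mem (E.algebraMap_mem _) (pow_mem hx 2))
        (mul_mem (E.algebraMap_mem _) hx)) (E.algebraMap_mem _)))
  have h2 : (2 : K) ∈ E := ofNat_mem E 2
  constructor
  · have := div_mem (add_mem hsumE hdiffE) h2
    rwa [show (y + z + (y - z)) / 2 = y by ring] at this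
  · have := div_mem (sub_mem hsumE hdiffE) h2
    rwa [show (y + z - (y - z)) / 2 = z by ring] at this

/-- In an extension of odd degree, an element of the base field that becomes a square
already is one. -/
theorem isSquare_of_isSquare_algebraMap_of_odd_finrank {F K : Type*} [Field F] [Field K]
    [Algebra F K] (hodd : Odd (Module.finrank F K)) {d : F} (h : IsSquare (algebraMap F K d)) :
    IsSquare d := by
  obtain ⟨δ, hδ⟩ := h
  have : FiniteDimensional F K := FiniteDimensional.of_finrank_pos hodd.pos
  have hint : IsIntegral F δ := IsIntegral.of_finite F δ
  have hle : (minpoly F δ).natDegree ≤ 2 := by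
    have hne : (X ^ 2 - C d : F[X]) ≠ 0 := X_pow_sub_C_ne_zero two_pos d
    have := natDegree_le_of_dvd (minpoly.dvd F δ (p := X ^ 2 - C d) (by simp [hδ, sq])) hne
    rwa [natDegree_X_pow_sub_C] at this
  have hdeg : (minpoly F δ).natDegree = 1 := by
    have h1 := minpoly.natDegree_pos hint
    have h2 : Odd (minpoly F δ).natDegree := hodd.of_dvd_nat (minpoly.degree_dvd hint)
    obtain ⟨k, hk⟩ := h2
    omega
  obtain ⟨s, rfl⟩ := minpoly.natDegree_eq_one_iff.1 hdeg
  exact ⟨s, (algebraMap F K).injective (by rw [hδ, map_mul])⟩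

open IntermediateField in
/-- The splitting field of an irreducible cubic has degree three if and only if the discriminant
is a square. -/
theorem Cubic.finrank_splittingField_eq_three_iff {F : Type*} [Field F] [CharZero F] {P : Cubic F}
    (ha : P.a ≠ 0) (hirr : Irreducible P.toPoly) :
    Module.finrank F P.toPoly.SplittingField = 3 ↔ IsSquare P.discr := by
  have hsplit := SplittingField.splits P.toPoly
  obtain ⟨x, y, z, h3⟩ := (Cubic.splits_iff_roots_eq_three ha).1 hsplit
  have hdiscr := Cubic.discr_eq_prod_three_roots ha h3
  refine ⟨fun h => isSquare_of_isSquare_algebraMap_of_odd_finrank (by rw [h]; decide)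
    (hdiscr ▸ IsSquare.sq _), ?_⟩
  rintro ⟨s, hs⟩
  have hd : P.discr ≠ 0 := by
    rw [Cubic.discr_ne_zero_iff_roots_nodup ha hsplit, Cubic.map_roots]
    exact nodup_roots hirr.separable.map
  obtain ⟨t, ht⟩ : ∃ t : F, algebraMap F P.toPoly.SplittingField P.a *
      algebraMap F P.toPoly.SplittingField P.a * (x - y) * (x - z) * (y - z) =
        algebraMap F P.toPoly.SplittingField t := by
    rw [hs, map_mul, ← sq, eq_comm, sq_eq_sq_iff_eq_or_eq_neg] at hdiscr
    rcases hdiscr with h | h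
    · exact ⟨s, h⟩
    · exact ⟨-s, by rw [h, map_neg]⟩
  have hroots : (P.toPoly.map (algebraMap F P.toPoly.SplittingField)).roots = {x, y, z} := by
    rw [← h3, Cubic.map_roots]
  have hxF : x ∈ F⟮x⟯ := mem_adjoin_simple_self F x
  obtain ⟨hy, hz⟩ := Cubic.mem_of_roots_of_sqrt_discr ha hd h3 hxF ht
  have htop : F⟮x⟯ = ⊤ := by
    rw [eq_top_iff, ← IntermediateField.toSubalgebra_le_toSubalgebra, top_toSubalgebra,
      ← SplittingField.adjoin_rootSet, Algebra.adjoin_le_iff]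
    intro w hw
    have hw' : w ∈ (P.toPoly.map (algebraMap F P.toPoly.SplittingField)).roots := by
      simpa [rootSet, aroots] using hw
    rw [hroots] at hw'
    simp only [Multiset.insert_eq_cons, Multiset.mem_cons, Multiset.mem_singleton] at hw'
    rcases hw' with rfl | rfl | rfl <;> assumption
  have hxroot : aeval x P.toPoly = 0 := by
    have hmem : x ∈ (P.toPoly.map (algebraMap F P.toPoly.SplittingField)).roots := by
      simp [hroots]
    exact (mem_aroots.1 hmem).2
  have hint : IsIntegral F x := IsIntegral.of_finite F x
  rw [← finrank_top', ← htop, adjoin.finrank hint, ← minpoly.eq_of_irreducible hirr hxroot,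
    natDegree_mul_C (inv_ne_zero (leadingCoeff_ne_zero.2 hirr.ne_zero)),
    Cubic.natDegree_of_a_ne_zero ha]

/-- A monic integral cubic with constant term a unit and without the roots `1` and `-1` is
irreducible over `ℚ`. -/
theorem Cubic.irreducible_of_isUnit_of_ne {b c d : ℤ} (hd : IsUnit d)
    (h₁ : 1 + b + c + d ≠ 0) (h₂ : -1 + b - c + d ≠ 0) :
    Irreducible (Cubic.toPoly ⟨(1 : ℚ), b, c, d⟩) := by
  have hdeg : (Cubic.toPoly ⟨(1 : ℚ), b, c, d⟩).natDegree = 3 :=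
    Cubic.natDegree_of_a_ne_zero one_ne_zero
  rw [irreducible_iff_roots_eq_zero_of_degree_le_three (by omega) (by omega),
    Multiset.eq_zero_iff_forall_notMem]
  intro r hr
  have hr0 : r ^ 3 + b * r ^ 2 + c * r + d = 0 := by
    simpa [Cubic.toPoly] using (mem_roots'.1 hr).2
  have hint : IsIntegral ℤ r := by
    refine ⟨Cubic.toPoly ⟨1, b, c, d⟩, Cubic.monic_of_a_eq_one rfl, ?_⟩
    simpa [Cubic.toPoly, eval₂_add, eval₂_mul, eval₂_C, -eq_intCast] using hr0
  obtain ⟨n, rfl⟩ := IsIntegrallyClosed.isIntegral_iff.1 hint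
  have hn : n ^ 3 + b * n ^ 2 + c * n + d = 0 := by
    simp only [eq_intCast] at hr0
    exact_mod_cast hr0
  have hunit : IsUnit n :=
    isUnit_of_dvd_unit ⟨-(n ^ 2 + b * n + c), by linear_combination hn⟩ hd
  rcases Int.isUnit_iff.1 hunit with rfl | rfl
  · exact h₁ (by linear_combination hn)
  · exact h₂ (by linear_combination hn)

/-- The integers `m` for which `m ^ 2 - 32` is a perfect square. -/
theorem Int.isSquare_sq_sub_thirtyTwo_iff {m : ℤ} :
    IsSquare (m ^ 2 - 32) ↔ m = 9 ∨ m = -9 ∨ m = 6 ∨ m = -6 := by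
  constructor
  · rintro ⟨s, hs⟩
    have hm : |m| * |m| = m ^ 2 := by rw [abs_mul_abs_self, sq]
    have hs' : |s| * |s| = s * s := abs_mul_abs_self s
    have hs0 := abs_nonneg s
    have hlt : |s| < |m| := by nlinarith [abs_nonneg m]
    have hbd : |m| ≤ 16 := by nlinarith
    obtain ⟨h₁, h₂⟩ := abs_le.1 hbd
    have hsm : |s| ≤ 16 := by omega
    obtain ⟨h₃, h₄⟩ := abs_le.1 hsm
    clear hm hs' hs0 hlt hbd hsm
    interval_cases m <;> first | omega | (exfalso; interval_cases s <;> omega)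
  · rintro (rfl | rfl | rfl | rfl)
    exacts [⟨7, rfl⟩, ⟨7, rfl⟩, ⟨2, rfl⟩, ⟨2, rfl⟩]

/-- When `m = (k ^ 2 - 13) / 4`, the number `m ^ 2 - 32` is a square exactly for `k = ± 7`. -/
theorem Int.isSquare_sq_sub_thirtyTwo_iff_abs_eq_seven {m k : ℤ} (h : 4 * m = k ^ 2 - 13) :
    IsSquare (m ^ 2 - 32) ↔ |k| = 7 := by
  rw [Int.isSquare_sq_sub_thirtyTwo_iff, abs_eq (by norm_num)]
  constructor
  · intro hm
    have hk : k ≤ 7 := by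
      rcases hm with rfl | rfl | rfl | rfl <;> nlinarith
    have hk' : -7 ≤ k := by
      rcases hm with rfl | rfl | rfl | rfl <;> nlinarith
    interval_cases k <;> omega
  · rintro (rfl | rfl) <;> omega

/-- Let `a ∈ ℤ`, `ε, ε' ∈ {1, -1}` and `f_a(X) = X³ + aX² − (a + ε + ε' + 1)X + ε`.
The splitting field of `f_a` over `ℚ` has degree `3` over `ℚ` (equivalently, its
Galois group is cyclic of order `3`) if and only if `ε = ε' = 1` or
`|2a − ε + ε' + 3| = 7`. -/
theorem cubic_family_cyclic_iff (a ε ε' : ℤ) (hε : ε = 1 ∨ ε = -1) (hε' : ε' = 1 ∨ ε' = -1) :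
    Module.finrank ℚ
        (Polynomial.SplittingField
          (X ^ 3 + C (a : ℚ) * X ^ 2 - C ((a : ℚ) + (ε : ℚ) + (ε' : ℚ) + 1) * X
            + C (ε : ℚ))) = 3 ↔
      (ε = 1 ∧ ε' = 1) ∨ |2 * a - ε + ε' + 3| = 7 := by
  have hpoly : X ^ 3 + C (a : ℚ) * X ^ 2 - C ((a : ℚ) + (ε : ℚ) + (ε' : ℚ) + 1) * X + C (ε : ℚ) =
      Cubic.toPoly ⟨(1 : ℚ), a, (-(a + ε + ε' + 1) : ℤ), ε⟩ := by
    simp only [Cubic.toPoly, Int.cast_neg, Int.cast_add, Int.cast_one, C_neg, C_1]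
    ring
  have hirr : Irreducible (Cubic.toPoly ⟨(1 : ℚ), a, (-(a + ε + ε' + 1) : ℤ), ε⟩) :=
    Cubic.irreducible_of_isUnit_of_ne (Int.isUnit_iff.2 hε) (by omega) (by omega)
  have hdiscr : Cubic.discr ⟨(1 : ℚ), a, (-(a + ε + ε' + 1) : ℤ), ε⟩ =
      (Cubic.discr ⟨1, a, -(a + ε + ε' + 1), ε⟩ : ℤ) := by
    simp [Cubic.discr]
  rw [hpoly, Cubic.finrank_splittingField_eq_three_iff one_ne_zero hirr, hdiscr,
    Rat.isSquare_intCast_iff]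
  simp only [Cubic.discr]
  rcases hε with rfl | rfl <;> rcases hε' with rfl | rfl
  · exact iff_of_true ⟨a ^ 2 + 3 * a + 9, by ring⟩ (Or.inl ⟨rfl, rfl⟩)
  · rw [← Int.isSquare_sq_sub_thirtyTwo_iff_abs_eq_seven (m := a ^ 2 + a - 3) (by ring)]
    norm_num
    ring_nf
  · rw [← Int.isSquare_sq_sub_thirtyTwo_iff_abs_eq_seven (m := a ^ 2 + 5 * a + 3) (by ring)]
    norm_num
    ring_nf
  · rw [← Int.isSquare_sq_sub_thirtyTwo_iff_abs_eq_seven (m := a ^ 2 + 3 * a - 1) (by ring)]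
    norm_num
    ring_nf
end

section
/- Fix ε, ε' ∈ {1, −1} and let f_a(X) = X³ + aX² − (a + ε + ε' + 1)X + ε for an integer a. For every δ > 0 there exists A₀ > 0 such that for every integer a with |a| ≥ A₀: f_a has three distinct real roots, and among its real roots there are u₀ and u₁ satisfying |a·u₀ − ε| < δ and |a·(u₁ − 1) − ε'| < δ. In particular, for |a| sufficiently large the field generated by a root of f_a is totally real. -/
open IntermediateField

/-- A monic cubic over a field with two distinct known roots factors completely. -/
lemma cubic_eq_prod_of_two_roots {K : Type*} [Field K] {a b c u v : K} (huv : u ≠ v)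
    (hu : u ^ 3 + a * u ^ 2 - b * u + c = 0) (hv : v ^ 3 + a * v ^ 2 - b * v + c = 0) (x : K) :
    x ^ 3 + a * x ^ 2 - b * x + c = (x - u) * (x - v) * (x - (-a - u - v)) := by
  have hb : u ^ 2 + u * v + v ^ 2 + a * (u + v) - b = 0 := by
    apply mul_left_cancel₀ (sub_ne_zero.mpr huv)
    linear_combination hu - hv
  linear_combination hu + (x - u) * hb

/-- A continuous function within `δ` of `t ↦ t - c` on `[c - δ, c + δ]` has a zero within `δ`
of `c`. -/
lemma exists_zero_of_near_sub {φ : ℝ → ℝ} (hφ : Continuous φ) {c δ : ℝ} (hδ : 0 < δ)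
    (h : ∀ t, |t - c| ≤ δ → |φ t - (t - c)| < δ) : ∃ t, φ t = 0 ∧ |t - c| < δ := by
  have h₁ := abs_lt.mp (h (c - δ) (by simp [abs_of_pos hδ]))
  have h₂ := abs_lt.mp (h (c + δ) (by simp [abs_of_pos hδ]))
  obtain ⟨t, ht, ht0⟩ := intermediate_value_Icc (by linarith : c - δ ≤ c + δ) hφ.continuousOn
    (show (0 : ℝ) ∈ Set.Icc (φ (c - δ)) (φ (c + δ)) from ⟨by linarith, by linarith⟩)
  have := h t (abs_le.mpr ⟨by linarith [ht.1], by linarith [ht.2]⟩)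
  refine ⟨t, ht0, ?_⟩
  rwa [ht0, zero_sub, abs_neg] at this

/-- If `|e|, |e'| ≤ 1`, the cubic has roots close to `e / a` and `1 + e' / a` for large `|a|`. -/
lemma exists_two_roots_near {e e' a δ : ℝ} (he : |e| ≤ 1) (he' : |e'| ≤ 1) (hδ : 0 < δ)
    (hδ1 : δ ≤ 1) (ha : 40 / δ ≤ |a|) :
    ∃ u v : ℝ, u ^ 3 + a * u ^ 2 - (a + e + e' + 1) * u + e = 0 ∧
      v ^ 3 + a * v ^ 2 - (a + e + e' + 1) * v + e = 0 ∧
      |a * u - e| < δ ∧ |a * (v - 1) - e'| < δ := by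
  have hapos : 0 < |a| := lt_of_lt_of_le (by positivity) ha
  have ha0 : a ≠ 0 := abs_pos.mp hapos
  obtain ⟨r, hr⟩ : ∃ r, r = a⁻¹ := ⟨_, rfl⟩
  have har : a * r = 1 := by rw [hr, mul_inv_cancel₀ ha0]
  have hrδ : 40 * |r| ≤ δ := by
    rw [hr, abs_inv, ← div_eq_mul_inv, div_le_iff₀ hapos]
    rwa [div_le_iff₀ hδ, mul_comm] at ha
  have hr1 : |r| ≤ 1 := by linarith
  have hrpos : 0 < |r| := by rw [hr, abs_inv]; positivity
  have hrr : |r ^ 2| ≤ 1 := by rw [abs_pow]; exact pow_le_one₀ (abs_nonneg r) hr1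
  have small (p : ℝ) (hp : |p| ≤ 36) : |r * p| < δ := by
    rw [abs_mul]
    nlinarith
  have bound {c t : ℝ} (hc : |c| ≤ 1) (ht : |t - c| ≤ δ) : |t| ≤ 2 := by
    have := abs_add_le (t - c) c
    rw [sub_add_cancel] at this
    linarith
  have hE : |e + e' + 1| ≤ 3 := by
    rw [abs_le] at he he' ⊢
    constructor <;> linarith [he.1, he.2, he'.1, he'.2]
  have hEt {t : ℝ} (ht : |t| ≤ 2) : |(e + e' + 1) * t| ≤ 6 := by
    rw [abs_mul]; nlinarith [abs_nonneg t, abs_nonneg (e + e' + 1)]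
  have ht2 {t : ℝ} (ht : |t| ≤ 2) : |t ^ 2| ≤ 4 := by
    rw [abs_pow]; nlinarith [abs_nonneg t]
  have ht3 {t : ℝ} (ht : |t| ≤ 2) : |r ^ 2 * t ^ 3| ≤ 8 := by
    rw [abs_mul, abs_pow t]
    have : |t| ^ 3 ≤ 2 ^ 3 := pow_le_pow_left₀ (abs_nonneg t) ht 3
    nlinarith [pow_nonneg (abs_nonneg t) 3]
  obtain ⟨t, ht0, ht⟩ := exists_zero_of_near_sub (c := e)
    (φ := fun t ↦ -((t * r) ^ 3 + a * (t * r) ^ 2 - (a + e + e' + 1) * (t * r) + e))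
    (by fun_prop) hδ (by
      intro t ht
      have hb := bound he ht
      convert small (-(r ^ 2 * t ^ 3 + t ^ 2 - (e + e' + 1) * t)) _ using 2
      · linear_combination (-r * t ^ 2 + t) * har
      · have h₁ := abs_le.mp (ht3 hb)
        have h₂ := abs_le.mp (ht2 hb)
        have h₃ := abs_le.mp (hEt hb)
        exact abs_le.mpr ⟨by linarith [h₁.2, h₂.2, h₃.1], by linarith [h₁.1, h₂.1, h₃.2]⟩)
  obtain ⟨s, hs0, hs⟩ := exists_zero_of_near_sub (c := e')
    (φ := fun s ↦ (1 + s * r) ^ 3 + a * (1 + s * r) ^ 2 - (a + e + e' + 1) * (1 + s * r) + e)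
    (by fun_prop) hδ (by
      intro s hs
      have hb := bound he' hs
      convert small (3 * s + 3 * (r * s ^ 2) + r ^ 2 * s ^ 3 + s ^ 2 - (e + e' + 1) * s) _ using 2
      · linear_combination (r * s ^ 2 + s) * har
      · have h₁ := abs_le.mp (ht3 hb)
        have h₂ := abs_le.mp (ht2 hb)
        have h₃ := abs_le.mp (hEt hb)
        have h₄ := abs_le.mp hb
        have h₅ : |r * s ^ 2| ≤ 4 := by
          rw [abs_mul]; nlinarith [ht2 hb, abs_nonneg (s ^ 2)]
        have h₆ := abs_le.mp h₅
        exact abs_le.mpr ⟨by linarith [h₁.1, h₂.1, h₃.2, h₄.1, h₆.1],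
          by linarith [h₁.2, h₂.2, h₃.1, h₄.2, h₆.2]⟩)
  refine ⟨t * r, 1 + s * r, neg_eq_zero.mp ht0, hs0, ?_, ?_⟩
  · rwa [show a * (t * r) = t by linear_combination t * har]
  · rwa [show a * (1 + s * r - 1) = s by linear_combination s * har]

/-- For large `|a|`, the roots near `e / a` and `1 + e' / a` differ from each other and from the
third root. -/
lemma roots_distinct {e e' a u v : ℝ} (he : |e| ≤ 1) (he' : |e'| ≤ 1) (ha : 40 ≤ |a|)
    (hu : |a * u - e| < 1) (hv : |a * (v - 1) - e'| < 1) :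
    u ≠ v ∧ u ≠ -a - u - v ∧ v ≠ -a - u - v := by
  have small {w c : ℝ} (hc : |c| ≤ 1) (hw : |a * w - c| < 1) : |w| ≤ 1 / 10 := by
    have := abs_add_le (a * w - c) c
    rw [sub_add_cancel, abs_mul] at this
    nlinarith [abs_nonneg w]
  have hu' := abs_le.mp (small he hu)
  have hv' := abs_le.mp (small he' hv)
  refine ⟨fun h ↦ by linarith [hu'.2, hv'.1], fun h ↦ ?_, fun h ↦ ?_⟩ <;>
  rcases le_abs.mp ha with h' | h' <;> linarith [hu'.1, hu'.2, hv'.1, hv'.2]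

/-- If every complex root of the integer cubic is real, so is every conjugate of every element of
the field generated by a root. -/
lemma im_eq_zero_of_cubic_roots_real {a b c : ℤ}
    (hreal : ∀ z : ℂ, z ^ 3 + a * z ^ 2 - b * z + c = 0 → z.im = 0) {u : ℂ}
    (hu : u ^ 3 + a * u ^ 2 - b * u + c = 0) (σ : ℚ⟮u⟯ →ₐ[ℚ] ℂ) (x : ℚ⟮u⟯) :
    (σ x).im = 0 := by
  have hgen : AdjoinSimple.gen ℚ u ^ 3 + a * AdjoinSimple.gen ℚ u ^ 2
      - b * AdjoinSimple.gen ℚ u + c = 0 := by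
    apply Subtype.ext
    simpa using hu
  have hσ : (σ (AdjoinSimple.gen ℚ u)).im = 0 := by
    apply hreal
    simpa using congrArg σ hgen
  have hconj : ((Complex.conjAe.restrictScalars ℚ : ℂ ≃ₐ[ℚ] ℂ) : ℂ →ₐ[ℚ] ℂ).comp σ = σ := by
    apply IntermediateField.algHom_ext_of_eq_adjoin _ rfl
    rintro y rfl
    exact Complex.conj_eq_iff_im.mpr hσ
  exact Complex.conj_eq_iff_im.mp (DFunLike.congr_fun hconj x)

/-- Fix `ε, ε' ∈ {1, -1}` and let `f_a(X) = X³ + aX² − (a + ε + ε' + 1)X + ε` for `a ∈ ℤ`.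
For every `δ > 0` there exists `A₀ > 0` such that for every integer `a` with `|a| ≥ A₀`:
`f_a` has three distinct real roots, and among its real roots there are `u₀` and `u₁`
satisfying `|a·u₀ − ε| < δ` and `|a·(u₁ − 1) − ε'| < δ`. In particular, for `|a|`
sufficiently large the field generated by a root of `f_a` is totally real. -/
theorem cubic_family_roots_asymptotics (ε ε' : ℤ) (hε : ε = 1 ∨ ε = -1)
    (hε' : ε' = 1 ∨ ε' = -1) :
    (∀ δ : ℝ, 0 < δ → ∃ A₀ : ℝ, 0 < A₀ ∧ ∀ a : ℤ, A₀ ≤ |(a : ℝ)| →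
      ∃ u₀ u₁ u₂ : ℝ, u₀ ≠ u₁ ∧ u₀ ≠ u₂ ∧ u₁ ≠ u₂ ∧
        (∀ u ∈ ({u₀, u₁, u₂} : Set ℝ),
          u ^ 3 + (a : ℝ) * u ^ 2 - ((a : ℝ) + (ε : ℝ) + (ε' : ℝ) + 1) * u + (ε : ℝ) = 0) ∧
        |(a : ℝ) * u₀ - (ε : ℝ)| < δ ∧ |(a : ℝ) * (u₁ - 1) - (ε' : ℝ)| < δ) ∧
    (∃ A₁ : ℝ, 0 < A₁ ∧ ∀ a : ℤ, A₁ ≤ |(a : ℝ)| → ∀ u : ℂ,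
      u ^ 3 + (a : ℂ) * u ^ 2 - ((a : ℂ) + (ε : ℂ) + (ε' : ℂ) + 1) * u + (ε : ℂ) = 0 →
      ∀ σ : (ℚ⟮u⟯ : IntermediateField ℚ ℂ) →ₐ[ℚ] ℂ, ∀ x, (σ x).im = 0) := by
  have he : |(ε : ℝ)| ≤ 1 := by rcases hε with rfl | rfl <;> simp
  have he' : |(ε' : ℝ)| ≤ 1 := by rcases hε' with rfl | rfl <;> simp
  constructor
  · intro δ hδ
    have hd : 0 < min δ 1 := lt_min hδ one_pos
    refine ⟨40 / min δ 1, by positivity, fun a ha ↦ ?_⟩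
    obtain ⟨u, v, hu, hv, hu', hv'⟩ := exists_two_roots_near he he' hd (min_le_right _ _) ha
    have ha40 : 40 ≤ |(a : ℝ)| :=
      ((le_div_iff₀ hd).mpr (by linarith [min_le_right δ 1])).trans ha
    obtain ⟨h₁, h₂, h₃⟩ := roots_distinct he he' ha40 (hu'.trans_le (min_le_right _ _))
      (hv'.trans_le (min_le_right _ _))
    refine ⟨u, v, -a - u - v, h₁, h₂, h₃, ?_, hu'.trans_le (min_le_left _ _),
      hv'.trans_le (min_le_left _ _)⟩
    rintro w (rfl | rfl | rfl)
    · exact hu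
    · exact hv
    · rw [cubic_eq_prod_of_two_roots h₁ hu hv, sub_self, mul_zero]
  · refine ⟨40, by norm_num, fun a ha z hz σ x ↦ ?_⟩
    obtain ⟨u, v, hu, hv, hu', hv'⟩ :=
      exists_two_roots_near he he' one_pos le_rfl (by rwa [div_one])
    have huv := (roots_distinct he he' ha hu' hv').1
    refine im_eq_zero_of_cubic_roots_real (a := a) (b := a + ε + ε' + 1) (c := ε) (fun w hw ↦ ?_)
      (by push_cast; exact hz) σ x
    push_cast at hw
    rw [cubic_eq_prod_of_two_roots (u := (u : ℂ)) (v := (v : ℂ)) (mod_cast huv)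
      (mod_cast hu) (mod_cast hv), mul_eq_zero, mul_eq_zero, sub_eq_zero, sub_eq_zero,
      sub_eq_zero] at hw
    rcases hw with (rfl | rfl) | rfl <;> simp
end

section
/- For an integer a, the polynomial f_a(X) = X⁴ + aX³ − aX + 1 is irreducible in ℚ[X] if and only if |a| ≠ 3. Moreover, X⁴ + 3X³ − 3X + 1 = (X² + X − 1)(X² + 2X − 1). -/
open Polynomial

/-- A monic polynomial of degree two is determined by its two lower coefficients. -/
lemma Polynomial.Monic.eq_quadratic {R : Type*} [Semiring R] {p : R[X]} (hp : p.Monic)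
    (h : p.natDegree = 2) : p = X ^ 2 + C (p.coeff 1) * X + C (p.coeff 0) := by
  have h2 : p.coeff 2 = 1 := h ▸ hp.coeff_natDegree
  conv_lhs => rw [p.as_sum_range_C_mul_X_pow, h]
  simp only [Finset.sum_range_succ, Finset.sum_range_zero, h2]
  simp only [pow_zero, mul_one, pow_one, zero_add, C_1, one_mul]
  abel

lemma quartic_family_no_int_root (a r : ℤ) : r ^ 4 + a * r ^ 3 - a * r + 1 ≠ 0 := by
  intro h
  have hu : IsUnit r := IsUnit.of_mul_eq_one (-(r ^ 3 + a * r ^ 2 - a)) (by linear_combination -h)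
  rcases Int.isUnit_iff.mp hu with rfl | rfl <;> norm_num at h

lemma abs_eq_three_of_quadratic_factors {a b c d e : ℤ} (h0 : c * e = 1)
    (h1 : b * e + c * d = -a) (h2 : c + e + b * d = 0) (h3 : b + d = a) : |a| = 3 := by
  rcases Int.mul_eq_one_iff_eq_one_or_neg_one.mp h0 with ⟨rfl, rfl⟩ | ⟨rfl, rfl⟩
  · have hb : b = -d := by linarith
    subst hb
    have hd : d ^ 2 = 2 := by linarith
    have : d < 2 := by nlinarith
    have : -2 < d := by nlinarith
    interval_cases d <;> omega
  · have hbd : b * d = 2 := by linarith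
    have hb : b ∣ 2 := ⟨d, hbd.symm⟩
    have : b ≤ 2 := Int.le_of_dvd (by norm_num) hb
    have : -b ≤ 2 := Int.le_of_dvd (by norm_num) ((neg_dvd).mpr hb)
    have : -2 ≤ b := by linarith
    rw [abs_eq (by norm_num)]
    interval_cases b <;> omega

lemma quartic_family_monic_natDegree {R : Type*} [CommRing R] [Nontrivial R] (a : R) :
    (X ^ 4 + C a * X ^ 3 - C a * X + 1 : R[X]).Monic ∧
      (X ^ 4 + C a * X ^ 3 - C a * X + 1 : R[X]).natDegree = 4 := by
  constructor
  · monicity!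
  · compute_degree!

lemma quartic_family_irreducible_int {a : ℤ} (ha : |a| ≠ 3) :
    Irreducible (X ^ 4 + C a * X ^ 3 - C a * X + 1 : ℤ[X]) := by
  obtain ⟨hm, hdeg⟩ := quartic_family_monic_natDegree a
  have hne : (X ^ 4 + C a * X ^ 3 - C a * X + 1 : ℤ[X]) ≠ 1 := by
    intro h
    rw [h, natDegree_one] at hdeg
    omega
  refine hm.irreducible_iff_natDegree'.mpr ⟨hne, ?_⟩
  intro f g hf hg hfg hmem
  rw [hdeg, Finset.mem_Ioc] at hmem
  have hsum : f.natDegree + g.natDegree = 4 := by rw [← hf.natDegree_mul hg, hfg, hdeg]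
  obtain hg1 | hg2 : g.natDegree = 1 ∨ g.natDegree = 2 := by omega
  · apply quartic_family_no_int_root a (-g.coeff 0)
    have h := congrArg (eval (-g.coeff 0)) hfg
    rw [eval_mul, hg.eq_X_add_C hg1] at h
    simp only [coeff_add, coeff_X_zero, coeff_C_zero, zero_add, eval_add, eval_sub, eval_mul,
      eval_pow, eval_X, eval_C, eval_one] at h
    linear_combination -h
  · rw [hf.eq_quadratic (by omega), hg.eq_quadratic hg2] at hfg
    generalize f.coeff 1 = b, f.coeff 0 = c, g.coeff 1 = d, g.coeff 0 = e at hfg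
    have key : (X ^ 2 + C b * X + C c) * (X ^ 2 + C d * X + C e) =
        X ^ 4 + C (b + d) * X ^ 3 + C (c + e + b * d) * X ^ 2 + C (b * e + c * d) * X
          + C (c * e) := by
      simp only [C_add, C_mul]
      ring
    rw [key] at hfg
    have h0 := congrArg (coeff · 0) hfg
    have h1 := congrArg (coeff · 1) hfg
    have h2 := congrArg (coeff · 2) hfg
    have h3 := congrArg (coeff · 3) hfg
    simp only [coeff_add, coeff_sub, coeff_C_mul, coeff_X_pow, coeff_X, coeff_C, coeff_one]
      at h0 h1 h2 h3
    norm_num at h0 h1 h2 h3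
    exact ha (abs_eq_three_of_quadratic_factors h0 h1 h2 h3)

lemma not_irreducible_mul_of_quadratics (b c d e : ℚ) :
    ¬ Irreducible ((X ^ 2 + C b * X + C c) * (X ^ 2 + C d * X + C e) : ℚ[X]) := by
  have hdeg (b c : ℚ) : (X ^ 2 + C b * X + C c : ℚ[X]).natDegree = 2 := by compute_degree!
  have hunit (b c : ℚ) : ¬ IsUnit (X ^ 2 + C b * X + C c : ℚ[X]) := fun h => by
    have := natDegree_eq_zero_of_isUnit h
    rw [hdeg] at this
    omega
  exact fun h => (h.isUnit_or_isUnit rfl).elim (hunit b c) (hunit d e)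

/-- For an integer `a`, the polynomial `f_a(X) = X⁴ + aX³ − aX + 1` is irreducible in
`ℚ[X]` if and only if `|a| ≠ 3`. Moreover,
`X⁴ + 3X³ − 3X + 1 = (X² + X − 1)(X² + 2X − 1)`. -/
theorem quartic_family_irreducible_iff (a : ℤ) :
    (Irreducible (X ^ 4 + C (a : ℚ) * X ^ 3 - C (a : ℚ) * X + 1) ↔ |a| ≠ 3) ∧
      (X ^ 4 + C (3 : ℚ) * X ^ 3 - C (3 : ℚ) * X + 1 =
        (X ^ 2 + X - 1) * (X ^ 2 + C (2 : ℚ) * X - 1)) := by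
  refine ⟨⟨fun h ha => ?_, fun ha => ?_⟩, ?_⟩
  · rcases (abs_eq (by norm_num)).mp ha with rfl | rfl
    · refine not_irreducible_mul_of_quadratics 1 (-1) 2 (-1) ?_
      convert h using 1
      simp only [Int.cast_ofNat, C_neg, C_1, C_ofNat]
      ring
    · refine not_irreducible_mul_of_quadratics (-1) (-1) (-2) (-1) ?_
      convert h using 1
      simp only [Int.cast_neg, Int.cast_ofNat, C_neg, C_1, C_ofNat]
      ring
  · have h := ((quartic_family_monic_natDegree a).1.irreducible_iff_irreducible_map_fraction_map
      (K := ℚ)).mp (quartic_family_irreducible_int ha)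
    simpa using h
  · simp only [C_ofNat]
    ring
end

section
/- Let a be an integer with |a| ≠ 3 and let u be a root (in an algebraic closure of ℚ) of f_a(X) = X⁴ + aX³ − aX + 1. Then F = ℚ(u) has degree 4 over ℚ, u ≠ −1, and both u and (u − 1)/(u + 1) are units of the ring of integers of F; that is, u, u⁻¹, (u − 1)/(u + 1) and (u + 1)/(u − 1) are all integral over ℤ. -/
open IntermediateField

open Polynomial in
/-- The integral quartic `X⁴ + aX³ − aX + 1` is irreducible when `|a| ≠ 3`. -/
theorem irreducible_quartic_family (a : ℤ) (ha : |a| ≠ 3) :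
    Irreducible (X ^ 4 + C a * X ^ 3 - C a * X + 1 : ℤ[X]) := by
  have hdeg : (X ^ 4 + C a * X ^ 3 - C a * X + 1 : ℤ[X]).natDegree = 4 := by compute_degree!
  have hmonic : (X ^ 4 + C a * X ^ 3 - C a * X + 1 : ℤ[X]).Monic := by monicity!
  rw [hmonic.irreducible_iff_natDegree']
  refine ⟨fun h => by norm_num [h, -eq_intCast] at hdeg, fun f g hf hg hfg hmem => ?_⟩
  have hsum : f.natDegree + g.natDegree = 4 := by rw [← hf.natDegree_mul hg, hfg, hdeg]
  have heval (x : ℤ) : f.eval x * g.eval x = x ^ 4 + a * x ^ 3 - a * x + 1 := by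
    rw [← eval_mul, hfg]
    simp
  rw [hdeg, Finset.mem_Ioc] at hmem
  obtain hg1 | hg2 : g.natDegree = 1 ∨ g.natDegree = 2 := by lia
  · have hroot := heval (-g.coeff 0)
    have hg0 : g.eval (-g.coeff 0) = 0 := by
      conv_lhs => rw [hg.as_sum, hg1]
      simp
    rw [hg0, mul_zero] at hroot
    have hunit : IsUnit (g.coeff 0) := isUnit_of_dvd_one
      ⟨-(g.coeff 0 ^ 3 - a * g.coeff 0 ^ 2 + a), by linear_combination -hroot⟩
    rcases Int.isUnit_iff.mp hunit with h | h <;> rw [h] at hroot <;> ring_nf at hroot <;> lia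
  · have quadratic_eval {p : ℤ[X]} (hp : p.Monic) (hp2 : p.natDegree = 2) (x : ℤ) :
        p.eval x = x ^ 2 + (p.coeff 1 * x + p.coeff 0) := by
      conv_lhs => rw [hp.as_sum, hp2]
      simp [Finset.sum_range_succ]
      ring
    simp only [quadratic_eval hf (by lia), quadratic_eval hg hg2] at heval
    generalize f.coeff 0 = c at heval
    generalize f.coeff 1 = b at heval
    generalize g.coeff 0 = e at heval
    generalize g.coeff 1 = d at heval
    have h0 : c * e = 1 := by linear_combination heval 0
    have h1 := heval 1
    have hn1 := heval (-1)
    have h2 := heval 2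
    have hcube : b + d = a := by linarith [heval (-2)]
    rcases Int.mul_eq_one_iff_eq_one_or_neg_one.mp h0 with ⟨rfl, rfl⟩ | ⟨rfl, rfl⟩
    · have hbd : b * d = -2 := by linarith
      have ha0 : a = 0 := by linarith
      have hsq : b * b = 2 := by linear_combination b * hcube - hbd + b * ha0
      have hlt : b < 2 := by nlinarith
      have hgt : -2 < b := by nlinarith
      interval_cases b <;> lia
    · have hbd : b * d = 2 := by linarith
      have hb : b ∣ 2 := ⟨d, hbd.symm⟩
      have hle : b ≤ 2 := Int.le_of_dvd two_pos hb
      have hge : -b ≤ 2 := Int.le_of_dvd two_pos (neg_dvd.mpr hb)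
      replace hge : -2 ≤ b := by lia
      apply ha
      interval_cases b <;>
        first | lia | (rw [show a = 3 by lia]; rfl) | (rw [show a = -3 by lia]; rfl)

open Polynomial in
/-- A root of a monic integral quartic is integral. -/
theorem isIntegral_of_quartic_eq_zero {R : Type*} [CommRing R] (b c d e : ℤ) (x : R)
    (hx : x ^ 4 + b * x ^ 3 + c * x ^ 2 + d * x + e = 0) : IsIntegral ℤ x :=
  ⟨X ^ 4 + C b * X ^ 3 + C c * X ^ 2 + C d * X + C e, by monicity!, by simpa [-eq_intCast] using hx⟩

open Polynomial in
/-- A root of `X⁴ + aX³ − aX + 1` generates a field of degree `4` over `ℚ` when `|a| ≠ 3`. -/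
theorem finrank_adjoin_quartic_family_root {K : Type*} [Field K] [Algebra ℚ K] (a : ℤ)
    (ha : |a| ≠ 3) (u : K) (hu : u ^ 4 + (a : K) * u ^ 3 - (a : K) * u + 1 = 0) :
    Module.finrank ℚ ℚ⟮u⟯ = 4 := by
  have hmonic : (X ^ 4 + C a * X ^ 3 - C a * X + 1 : ℤ[X]).Monic := by monicity!
  have hdeg : (X ^ 4 + C a * X ^ 3 - C a * X + 1 : ℤ[X]).natDegree = 4 := by compute_degree!
  have hirr := (hmonic.irreducible_iff_irreducible_map_fraction_map (K := ℚ)).mp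
    (irreducible_quartic_family a ha)
  have hmin := minpoly.eq_of_irreducible_of_monic hirr (x := u) (by simpa using hu)
    (hmonic.map _)
  have hint : IsIntegral ℚ u := (isIntegral_of_quartic_eq_zero a 0 (-a) 1 u
    (by push_cast; linear_combination hu)).tower_top
  rw [adjoin.finrank hint, ← hmin, hmonic.natDegree_map, hdeg]

/-- Let `a` be an integer with `|a| ≠ 3` and let `u` be a root, in an algebraic closure
of `ℚ`, of `f_a(X) = X⁴ + aX³ − aX + 1`. Then `F = ℚ(u)` has degree `4` over `ℚ`,
`u ≠ -1`, and both `u` and `(u − 1)/(u + 1)` are units of the ring of integers of `F`;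
that is, `u`, `u⁻¹`, `(u − 1)/(u + 1)` and `(u + 1)/(u − 1)` are all integral over `ℤ`. -/
theorem quartic_family_root_unit (a : ℤ) (ha : |a| ≠ 3) (u : AlgebraicClosure ℚ)
    (hu : u ^ 4 + (a : AlgebraicClosure ℚ) * u ^ 3 - (a : AlgebraicClosure ℚ) * u + 1 = 0) :
    Module.finrank ℚ (ℚ⟮u⟯ : IntermediateField ℚ (AlgebraicClosure ℚ)) = 4 ∧
      u ≠ -1 ∧ IsIntegral ℤ u ∧ IsIntegral ℤ u⁻¹ ∧
      IsIntegral ℤ ((u - 1) / (u + 1)) ∧ IsIntegral ℤ ((u + 1) / (u - 1)) := by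
  have hu0 : u ≠ 0 := by
    rintro rfl
    norm_num at hu
  have hadd : u + 1 ≠ 0 := fun h => by
    have : (2 : AlgebraicClosure ℚ) = 0 := by
      linear_combination hu - (u ^ 3 + (a - 1) * u ^ 2 + (1 - a) * u - 1) * h
    norm_num at this
  have hsub : u - 1 ≠ 0 := fun h => by
    have : (2 : AlgebraicClosure ℚ) = 0 := by
      linear_combination hu - (u ^ 3 + (a + 1) * u ^ 2 + (a + 1) * u + 1) * h
    norm_num at this
  refine ⟨finrank_adjoin_quartic_family_root a ha u hu, fun h => hadd (by simp [h]),
    isIntegral_of_quartic_eq_zero a 0 (-a) 1 u ?_,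
    isIntegral_of_quartic_eq_zero (-a) 0 a 1 _ ?_,
    isIntegral_of_quartic_eq_zero (-2 * a) 6 (2 * a) 1 _ ?_,
    isIntegral_of_quartic_eq_zero (2 * a) 6 (-2 * a) 1 _ ?_⟩
  all_goals push_cast
  · linear_combination hu
  · field_simp
    linear_combination hu
  · field_simp
    linear_combination 8 * hu
  · field_simp
    linear_combination 8 * hu
end

section
/- For every integer a with a ≠ 0 and |a| ≠ 3, the Galois group of the splitting field over ℚ of f_a(X) = X⁴ + aX³ − aX + 1 is isomorphic to the dihedral group of order 8. -/
open Polynomial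

/-- The homomorphism out of a dihedral group determined by a rotation and a reflection. -/
def DihedralGroup.liftHom {n : ℕ} [NeZero n] {G : Type*} [Group G] (σ τ : G) (hσ : σ ^ n = 1)
    (hτ : τ * τ = 1) (h : σ * τ * σ = τ) : DihedralGroup n →* G where
  toFun
    | .r i => σ ^ i.val
    | .sr i => τ * σ ^ i.val
  map_one' := by
    change σ ^ (0 : ZMod n).val = 1
    simp
  map_mul' := by
    have hadd (i j : ZMod n) : σ ^ (i + j).val = σ ^ i.val * σ ^ j.val := by
      rw [ZMod.val_add, ← pow_eq_pow_mod _ hσ, pow_add]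
    have hconj (k : ℕ) : σ ^ k * τ * σ ^ k = τ := by
      induction k with
      | zero => simp
      | succ k ih =>
        calc σ ^ (k + 1) * τ * σ ^ (k + 1) = σ ^ k * (σ * τ * σ) * σ ^ k := by
              rw [pow_succ σ k]
              nth_rewrite 2 [← pow_succ]
              rw [pow_succ']
              simp only [mul_assoc]
          _ = τ := by rw [h, ih]
    have hsub (i j : ZMod n) : τ * σ ^ (j - i).val = σ ^ i.val * (τ * σ ^ j.val) := by
      calc τ * σ ^ (j - i).val = σ ^ i.val * τ * (σ ^ i.val * σ ^ (j - i).val) := by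
            rw [← mul_assoc, hconj]
        _ = σ ^ i.val * (τ * σ ^ j.val) := by rw [← hadd, add_sub_cancel, mul_assoc]
    rintro (i | i) (j | j)
    · exact hadd i j
    · exact hsub i j
    · change τ * σ ^ (i + j).val = τ * σ ^ i.val * σ ^ j.val
      rw [hadd, mul_assoc]
    · change σ ^ (j - i).val = τ * σ ^ i.val * (τ * σ ^ j.val)
      rw [mul_assoc, ← hsub, ← mul_assoc, hτ, one_mul]

/-- In a Galois extension, a square root of a nonsquare is negated by some automorphism. -/
lemma exists_algEquiv_eq_neg {F K : Type*} [Field F] [Field K] [Algebra F K]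
    [FiniteDimensional F K] [IsGalois F K] {d : F} {x : K} (hx : x ^ 2 = algebraMap F K d) (hd : ¬ IsSquare d) :
    ∃ g : K ≃ₐ[F] K, g x = -x := by
  by_contra! h
  have hfix (g : K ≃ₐ[F] K) : g x = x := by
    have hg : (g x) ^ 2 = x ^ 2 := by rw [← map_pow, hx, g.commutes]
    exact (sq_eq_sq_iff_eq_or_eq_neg.mp hg).resolve_right (h g)
  obtain ⟨y, rfl⟩ := (IsGalois.mem_range_algebraMap_iff_fixed x).mpr hfix
  refine hd ⟨y, (algebraMap F K).injective ?_⟩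
  rw [← hx, map_mul, sq]

/-- The Galois group of a Galois extension generated by the roots `±β, ±γ` of a biquadratic
polynomial `X ^ 4 - s * X ^ 2 + p` is dihedral of order `8` as soon as none of `p`,
`s ^ 2 - 4 * p` and their product is a square. -/
lemma nonempty_dihedralGroup_mulEquiv_of_biquadratic {F K : Type*} [Field F] [Field K]
    [Algebra F K] [FiniteDimensional F K] [IsGalois F K] (h2 : (2 : K) ≠ 0) {s p : F} {β γ : K}
    (hs : β ^ 2 + γ ^ 2 = algebraMap F K s) (hp : β ^ 2 * γ ^ 2 = algebraMap F K p)
    (hgen : ∀ g h : K ≃ₐ[F] K, g β = h β → g γ = h γ → g = h)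
    (hp_sq : ¬ IsSquare p) (hd_sq : ¬ IsSquare (s ^ 2 - 4 * p))
    (hpd_sq : ¬ IsSquare (p * (s ^ 2 - 4 * p))) :
    Nonempty (DihedralGroup 4 ≃* (K ≃ₐ[F] K)) := by
  have hδ : (β * γ) ^ 2 = algebraMap F K p := by rw [mul_pow, hp]
  have hα : (β ^ 2 - γ ^ 2) ^ 2 = algebraMap F K (s ^ 2 - 4 * p) := by
    simp only [map_sub, map_mul, map_pow, map_ofNat, ← hs, ← hp]
    ring
  have hαδ : (β * γ * (β ^ 2 - γ ^ 2)) ^ 2 = algebraMap F K (p * (s ^ 2 - 4 * p)) := by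
    rw [mul_pow, hδ, hα, map_mul]
  have hp0 : β * γ ≠ 0 := by
    intro h
    rw [h, zero_pow two_ne_zero, eq_comm, map_eq_zero] at hδ
    exact hp_sq (hδ ▸ IsSquare.zero)
  have hd0 : β ^ 2 - γ ^ 2 ≠ 0 := by
    intro h
    rw [h, zero_pow two_ne_zero, eq_comm, map_eq_zero] at hα
    exact hd_sq (hα ▸ IsSquare.zero)
  have hβ : β ≠ 0 := left_ne_zero_of_mul hp0
  have hγ : γ ≠ 0 := right_ne_zero_of_mul hp0
  have hβγ : β ≠ γ := fun h => hd0 (by rw [h, sub_self])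
  have hβγ' : β ≠ -γ := fun h => hd0 (by rw [h, neg_sq, sub_self])
  have hββ : β ≠ -β := fun h => mul_ne_zero h2 hβ (by linear_combination h)
  have hγγ : γ ≠ -γ := fun h => mul_ne_zero h2 hγ (by linear_combination h)
  -- Each automorphism preserves or exchanges the pairs `±β` and `±γ`.
  have hact (g : K ≃ₐ[F] K) : ((g β = β ∨ g β = -β) ∧ (g γ = γ ∨ g γ = -γ)) ∨
      ((g β = γ ∨ g β = -γ) ∧ (g γ = β ∨ g γ = -β)) := by
    have hgs : (g β) ^ 2 + (g γ) ^ 2 = β ^ 2 + γ ^ 2 := by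
      rw [← map_pow, ← map_pow, ← map_add, hs, g.commutes]
    have hgp : (g β) ^ 2 * (g γ) ^ 2 = β ^ 2 * γ ^ 2 := by
      rw [← map_pow, ← map_pow, ← map_mul, hp, g.commutes]
    have hz : ((g β) ^ 2 - β ^ 2) * ((g β) ^ 2 - γ ^ 2) = 0 := by
      linear_combination (g β) ^ 2 * hgs - hgp
    rcases mul_eq_zero.mp hz with hz | hz
    · exact .inl ⟨sq_eq_sq_iff_eq_or_eq_neg.mp (sub_eq_zero.mp hz),
        sq_eq_sq_iff_eq_or_eq_neg.mp (by linear_combination hgs - hz)⟩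
    · exact .inr ⟨sq_eq_sq_iff_eq_or_eq_neg.mp (sub_eq_zero.mp hz),
        sq_eq_sq_iff_eq_or_eq_neg.mp (by linear_combination hgs - hz)⟩
  have hsgn {d : F} {x : K} (hx : x ^ 2 = algebraMap F K d) (g : K ≃ₐ[F] K) :
      g x = x ∨ g x = -x :=
    sq_eq_sq_iff_eq_or_eq_neg.mp (by rw [← map_pow, hx, g.commutes])
  obtain ⟨g₁, hg₁⟩ := exists_algEquiv_eq_neg hα hd_sq
  obtain ⟨g₂, hg₂⟩ := exists_algEquiv_eq_neg hδ hp_sq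
  obtain ⟨g₃, hg₃⟩ := exists_algEquiv_eq_neg hαδ hpd_sq
  obtain ⟨σ, hσα, hσδ⟩ : ∃ σ : K ≃ₐ[F] K,
      σ (β ^ 2 - γ ^ 2) = -(β ^ 2 - γ ^ 2) ∧ σ (β * γ) = -(β * γ) := by
    rcases hsgn hδ g₁ with h₁ | h₁
    · rcases hsgn hα g₂ with h₂ | h₂
      · exact ⟨g₁ * g₂, by rw [AlgEquiv.mul_apply, h₂, hg₁],
          by rw [AlgEquiv.mul_apply, hg₂, map_neg, h₁]⟩
      · exact ⟨g₂, h₂, hg₂⟩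
    · exact ⟨g₁, hg₁, h₁⟩
  obtain ⟨τ, hτα, hτδ⟩ : ∃ τ : K ≃ₐ[F] K,
      τ (β ^ 2 - γ ^ 2) = -(β ^ 2 - γ ^ 2) ∧ τ (β * γ) = β * γ := by
    rw [map_mul] at hg₃
    have hne := mul_ne_zero h2 (mul_ne_zero hp0 hd0)
    rcases hsgn hδ g₃ with h₁ | h₁ <;> rcases hsgn hα g₃ with h₃ | h₃
    · rw [h₁, h₃] at hg₃
      exact absurd (by linear_combination hg₃) hne
    · exact ⟨g₃, h₃, h₁⟩
    · exact ⟨g₃ * σ, by rw [AlgEquiv.mul_apply, hσα, map_neg, h₃],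
        by rw [AlgEquiv.mul_apply, hσδ, map_neg, h₁, neg_neg]⟩
    · rw [h₁, h₃] at hg₃
      exact absurd (by linear_combination hg₃) hne
  -- An automorphism negating `β ^ 2 - γ ^ 2` exchanges the two pairs.
  have hswap (g : K ≃ₐ[F] K) (hg : g (β ^ 2 - γ ^ 2) = -(β ^ 2 - γ ^ 2)) :
      (g β = γ ∨ g β = -γ) ∧ (g γ = β ∨ g γ = -β) := by
    refine (hact g).resolve_left fun ⟨h₁, h₃⟩ => mul_ne_zero h2 hd0 ?_
    rw [map_sub, map_pow, map_pow, sq_eq_sq_iff_eq_or_eq_neg.mpr h₁,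
      sq_eq_sq_iff_eq_or_eq_neg.mpr h₃] at hg
    linear_combination hg
  rw [map_mul] at hσδ hτδ
  have hne := mul_ne_zero h2 hp0
  have hσ : (σ β = γ ∧ σ γ = -β) ∨ (σ β = -γ ∧ σ γ = β) := by
    obtain ⟨h₁ | h₁, h₃ | h₃⟩ := hswap σ hσα <;> rw [h₁, h₃] at hσδ
    · exact absurd (by linear_combination hσδ) hne
    · exact .inl ⟨h₁, h₃⟩
    · exact .inr ⟨h₁, h₃⟩
    · exact absurd (by linear_combination hσδ) hne
  have hτ : (τ β = γ ∧ τ γ = β) ∨ (τ β = -γ ∧ τ γ = -β) := by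
    obtain ⟨h₁ | h₁, h₃ | h₃⟩ := hswap τ hτα <;> rw [h₁, h₃] at hτδ
    · exact .inl ⟨h₁, h₃⟩
    · exact absurd (by linear_combination -hτδ) hne
    · exact absurd (by linear_combination -hτδ) hne
    · exact .inr ⟨h₁, h₃⟩
  have hσ2β : σ (σ β) = -β := by rcases hσ with ⟨h₁, h₃⟩ | ⟨h₁, h₃⟩ <;> simp [h₁, h₃]
  have hσ2γ : σ (σ γ) = -γ := by rcases hσ with ⟨h₁, h₃⟩ | ⟨h₁, h₃⟩ <;> simp [h₁, h₃]
  have hσ4 : σ ^ 4 = 1 := by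
    apply hgen <;> simp [pow_succ, hσ2β, hσ2γ]
  have hτ2 : τ * τ = 1 := by
    apply hgen <;> rcases hτ with ⟨h₁, h₃⟩ | ⟨h₁, h₃⟩ <;> simp [h₁, h₃]
  have hστ : σ * τ * σ = τ := by
    apply hgen <;> rcases hσ with ⟨h₁, h₃⟩ | ⟨h₁, h₃⟩ <;>
      rcases hτ with ⟨h₅, h₆⟩ | ⟨h₅, h₆⟩ <;> simp [h₁, h₃, h₅, h₆]
  let φ : DihedralGroup 4 →* (K ≃ₐ[F] K) := DihedralGroup.liftHom σ τ hσ4 hτ2 hστ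
  have hφσ : φ (.r 1) = σ := pow_one σ
  have hφτ : φ (.sr 0) = τ := mul_one τ
  refine ⟨MulEquiv.ofBijective φ ⟨?_, ?_⟩⟩
  · rw [injective_iff_map_eq_one]
    intro x hx
    have hxβ : φ x β = β := by rw [hx, AlgEquiv.one_apply]
    have hxγ : φ x γ = γ := by rw [hx, AlgEquiv.one_apply]
    obtain i | i := x
    · change (σ ^ i.val) β = β at hxβ
      fin_cases i
      · rfl
      all_goals
        exfalso
        simp [ZMod.val, pow_succ, hσ2β] at hxβ
        grind
    · change (τ * σ ^ i.val) β = β at hxβ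
      change (τ * σ ^ i.val) γ = γ at hxγ
      exfalso
      fin_cases i <;> simp [ZMod.val, pow_succ, hσ2β, hσ2γ] at hxβ hxγ <;> grind
  · have hmemσ : σ ∈ φ.range := ⟨_, hφσ⟩
    have hmemτ : τ ∈ φ.range := ⟨_, hφτ⟩
    rw [← MonoidHom.range_eq_top, Subgroup.eq_top_iff']
    have hfix (g : K ≃ₐ[F] K) (hg : g β = β) : g ∈ φ.range := by
      obtain ⟨-, h | h⟩ := (hact g).resolve_right (by
        rintro ⟨h | h, -⟩
        exacts [hβγ (hg ▸ h), hβγ' (hg ▸ h)])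
      · rw [hgen g 1 hg h]
        exact one_mem _
      · rcases hσ with ⟨h₁, h₃⟩ | ⟨h₁, h₃⟩ <;> rcases hτ with ⟨h₅, h₆⟩ | ⟨h₅, h₆⟩
        · rw [hgen g (τ * σ) (by simp [*]) (by simp [*])]
          exact mul_mem hmemτ hmemσ
        · rw [hgen g (σ * τ) (by simp [*]) (by simp [*])]
          exact mul_mem hmemσ hmemτ
        · rw [hgen g (σ * τ) (by simp [*]) (by simp [*])]
          exact mul_mem hmemσ hmemτ
        · rw [hgen g (τ * σ) (by simp [*]) (by simp [*])]
          exact mul_mem hmemτ hmemσ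
    have hpres (g : K ≃ₐ[F] K) (hg : g β = β ∨ g β = -β) : g ∈ φ.range := by
      rcases hg with hg | hg
      · exact hfix g hg
      · rw [← Subgroup.mul_mem_cancel_left _ (mul_mem hmemσ hmemσ)]
        exact hfix _ (by simp [hg, hσ2β])
    intro g
    obtain ⟨hg, -⟩ | ⟨hg, -⟩ := hact g
    · exact hpres g hg
    · rw [← Subgroup.mul_mem_cancel_left _ hmemτ]
      refine hpres _ ?_
      rcases hτ with ⟨-, h⟩ | ⟨-, h⟩ <;> rcases hg with hg | hg <;> simp [h, hg]

lemma Int.not_isSquare_of_sq_lt {m n : ℤ} (hm : 0 ≤ m) (h₁ : m ^ 2 < n)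
    (h₂ : n < (m + 1) ^ 2) : ¬ IsSquare n := by
  rintro ⟨b, rfl⟩
  rw [← sq] at h₁ h₂
  have h₃ := sq_lt_sq.mp h₁
  have h₄ := sq_lt_sq.mp h₂
  rw [abs_of_nonneg hm] at h₃
  rw [abs_of_nonneg (by lia : 0 ≤ m + 1)] at h₄
  lia

lemma Int.not_isSquare_sq_add_one {a : ℤ} (ha : a ≠ 0) : ¬ IsSquare (a ^ 2 + 1) := by
  rw [← sq_abs]
  have := abs_pos.mpr ha
  exact Int.not_isSquare_of_sq_lt (abs_nonneg a) (by lia) (by nlinarith)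

lemma Int.not_isSquare_of_neg {n : ℤ} (h : n < 0) : ¬ IsSquare n :=
  fun hn => h.not_ge hn.nonneg

lemma Int.not_isSquare_sq_sub_eight {a : ℤ} (ha : |a| ≠ 3) : ¬ IsSquare (a ^ 2 - 8) := by
  rw [← sq_abs]
  generalize hb : |a| = b at ha
  have hb0 : 0 ≤ b := hb ▸ abs_nonneg a
  rcases lt_or_ge b 5 with h | h
  · interval_cases b
    · exact Int.not_isSquare_of_neg (by norm_num)
    · exact Int.not_isSquare_of_neg (by norm_num)
    · exact Int.not_isSquare_of_neg (by norm_num)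
    · exact absurd rfl ha
    · exact Int.not_isSquare_of_sq_lt (m := 2) (by norm_num) (by norm_num) (by norm_num)
  · exact Int.not_isSquare_of_sq_lt (m := b - 1) (by lia) (by nlinarith) (by nlinarith)

lemma Int.not_isSquare_sq_add_one_mul_sq_sub_eight {a : ℤ} (ha : |a| ≠ 3) :
    ¬ IsSquare ((a ^ 2 + 1) * (a ^ 2 - 8)) := by
  rw [← sq_abs]
  generalize hb : |a| = b at ha
  have hb0 : 0 ≤ b := hb ▸ abs_nonneg a
  rcases lt_or_ge b 5 with h | h
  · interval_cases b
    · exact Int.not_isSquare_of_neg (by norm_num)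
    · exact Int.not_isSquare_of_neg (by norm_num)
    · exact Int.not_isSquare_of_neg (by norm_num)
    · exact absurd rfl ha
    · exact Int.not_isSquare_of_sq_lt (m := 11) (by norm_num) (by norm_num) (by norm_num)
  · exact Int.not_isSquare_of_sq_lt (m := b ^ 2 - 4) (by nlinarith) (by nlinarith) (by nlinarith)

lemma not_isSquare_sq_mul {F : Type*} [Field F] {c x : F} (hc : c ≠ 0) (hx : ¬ IsSquare x) :
    ¬ IsSquare (c ^ 2 * x) := by
  rintro ⟨y, hy⟩
  refine hx ⟨y / c, ?_⟩
  field_simp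
  linear_combination hy

/-- The Galois group of `X ^ 4 + a * X ^ 3 - a * X + 1` over an arbitrary splitting field. -/
lemma nonempty_dihedralGroup_mulEquiv_of_quartic_splits {K : Type*} [Field K] [Algebra ℚ K]
    [FiniteDimensional ℚ K] [IsGalois ℚ K] {a : ℤ} (ha : a ≠ 0) (ha' : |a| ≠ 3) {f : ℚ[X]}
    (hf : f = X ^ 4 + C (a : ℚ) * X ^ 3 - C (a : ℚ) * X + 1)
    (hsplits : (f.map (algebraMap ℚ K)).Splits)
    (hgen : ∀ g h : K ≃ₐ[ℚ] K, (∀ x, aeval x f = 0 → g x = h x) → g = h) :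
    Nonempty (DihedralGroup 4 ≃* (K ≃ₐ[ℚ] K)) := by
  have : CharZero K := algebraRat.charZero K
  have haQ : (a : ℚ) ≠ 0 := Int.cast_ne_zero.mpr ha
  have haK : (a : K) ≠ 0 := Int.cast_ne_zero.mpr ha
  have hdeg : f.degree = 4 := by rw [hf]; compute_degree!
  obtain ⟨x₁, hx₁⟩ := hsplits.exists_eval_eq_zero (by rw [degree_map, hdeg]; decide)
  rw [eval_map_algebraMap] at hx₁
  replace hx₁ : x₁ ^ 4 + a * x₁ ^ 3 - a * x₁ + 1 = 0 := by simpa [hf] using hx₁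
  have hx₁0 : x₁ ≠ 0 := by
    rintro rfl
    simp at hx₁
  obtain ⟨y₁, hy₁⟩ : ∃ y, y = x₁ - x₁⁻¹ := ⟨_, rfl⟩
  have hy₁x : x₁ ^ 2 - y₁ * x₁ - 1 = 0 := by rw [hy₁]; field_simp; ring
  have hy₁a : y₁ ^ 2 + a * y₁ + 2 = 0 := by
    rw [hy₁]
    field_simp
    linear_combination hx₁
  obtain ⟨y₂, hsum⟩ : ∃ y₂, (a : K) = -y₁ - y₂ := ⟨-a - y₁, by ring⟩
  have hprod : y₁ * y₂ = 2 := by linear_combination -hy₁a + y₁ * hsum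
  have hy₂a : y₂ ^ 2 + a * y₂ + 2 = 0 := by linear_combination -hprod + y₂ * hsum
  have hfac : f.map (algebraMap ℚ K) = (X ^ 2 - C y₁ * X - 1) * (X ^ 2 - C y₂ * X - 1) := by
    have hprodC : C y₁ * C y₂ = (2 : K[X]) := by rw [← C_mul, hprod, map_ofNat]
    have hsumC : (a : K[X]) = -C y₁ - C y₂ := by
      rw [← C_neg, ← C_sub, ← hsum, map_intCast]
    simp only [hf, map_intCast, Polynomial.map_add, Polynomial.map_sub, Polynomial.map_mul,
      Polynomial.map_pow, Polynomial.map_intCast, map_X, Polynomial.map_one, hsumC]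
    linear_combination (-X ^ 2) * hprodC
  obtain ⟨x₂, hy₂x⟩ : ∃ x : K, x ^ 2 - y₂ * x - 1 = 0 := by
    have hdeg₂ : (X ^ 2 - C y₂ * X - 1 : K[X]).degree = 2 := by compute_degree!
    have hne : f.map (algebraMap ℚ K) ≠ 0 := by
      rw [← degree_ne_bot, degree_map, hdeg]
      decide
    obtain ⟨x, hx⟩ := (hsplits.of_dvd hne (hfac ▸ dvd_mul_left _ _)).exists_eval_eq_zero
      (by rw [hdeg₂]; decide)
    exact ⟨x, by simpa using hx⟩
  have hβ : (2 * x₁ - y₁) ^ 2 = 2 - a * y₁ := by linear_combination 4 * hy₁x + hy₁a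
  have hγ : (2 * x₂ - y₂) ^ 2 = 2 - a * y₂ := by linear_combination 4 * hy₂x + hy₂a
  -- The roots of `X ^ 2 - y * X - 1` are rational functions of `2 * x - y`.
  have hdet (g h : K ≃ₐ[ℚ] K) {x y z : K} (hx : x ^ 2 - y * x - 1 = 0)
      (hy : (2 * x - y) ^ 2 = 2 - a * y) (hgh : g (2 * x - y) = h (2 * x - y))
      (hz : z ^ 2 - y * z - 1 = 0) : g z = h z := by
    have hgy : g y = h y := by
      have h₁ := congrArg g hy
      have h₂ := congrArg h hy
      rw [map_pow, hgh, ← map_pow, h₂] at h₁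
      simp only [map_sub, map_mul, map_ofNat, map_intCast] at h₁
      exact mul_left_cancel₀ haK (by linear_combination h₁)
    have hgx : g x = h x := by
      simp only [map_sub, map_mul, map_ofNat, hgy] at hgh
      exact mul_left_cancel₀ two_ne_zero (by linear_combination hgh)
    have hz' : (z - x) * (z - (y - x)) = 0 := by linear_combination hz - hx
    rcases mul_eq_zero.mp hz' with hz' | hz' <;> rw [sub_eq_zero.mp hz']
    · exact hgx
    · rw [map_sub, map_sub, hgy, hgx]
  have hQ {n : ℤ} (hn : ¬ IsSquare n) : ¬ IsSquare (n : ℚ) := by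
    rwa [Rat.isSquare_intCast_iff]
  refine nonempty_dihedralGroup_mulEquiv_of_biquadratic (s := a ^ 2 + 4) (p := 4 * (a ^ 2 + 1))
    (β := 2 * x₁ - y₁) (γ := 2 * x₂ - y₂) two_ne_zero ?_ ?_ ?_ ?_ ?_ ?_
  · rw [hβ, hγ]
    simp only [map_add, map_pow, map_ofNat, map_intCast]
    linear_combination (-a) * hsum
  · rw [hβ, hγ]
    simp only [map_add, map_mul, map_pow, map_ofNat, map_intCast, map_one]
    linear_combination (-2 * a) * hsum + a ^ 2 * hprod
  · intro g h hgh₁ hgh₂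
    refine hgen g h fun z hz => ?_
    rw [← eval_map_algebraMap, hfac] at hz
    replace hz : (z ^ 2 - y₁ * z - 1) * (z ^ 2 - y₂ * z - 1) = 0 := by simpa using hz
    rcases mul_eq_zero.mp hz with hz | hz
    · exact hdet g h hy₁x hβ hgh₁ hz
    · exact hdet g h hy₂x hγ hgh₂ hz
  · have := not_isSquare_sq_mul two_ne_zero (hQ (Int.not_isSquare_sq_add_one ha))
    push_cast at this
    convert this using 2
    ring
  · have := not_isSquare_sq_mul haQ (hQ (Int.not_isSquare_sq_sub_eight ha'))
    push_cast at this
    convert this using 2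
    ring
  · have := not_isSquare_sq_mul (mul_ne_zero two_ne_zero haQ)
      (hQ (Int.not_isSquare_sq_add_one_mul_sq_sub_eight ha'))
    push_cast at this
    convert this using 2
    ring

lemma isGalois_splittingField {F : Type*} [Field F] [CharZero F] (f : F[X]) :
    IsGalois F f.SplittingField := ⟨⟩

/-- For every integer `a` with `a ≠ 0` and `|a| ≠ 3`, the Galois group of the splitting
field over `ℚ` of `f_a(X) = X⁴ + aX³ − aX + 1` is isomorphic to the dihedral group of
order `8`. -/
theorem quartic_family_galois_dihedral (a : ℤ) (ha : a ≠ 0) (ha' : |a| ≠ 3) :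
    Nonempty ((X ^ 4 + C (a : ℚ) * X ^ 3 - C (a : ℚ) * X + 1).Gal ≃* DihedralGroup 4) := by
  set f : ℚ[X] := X ^ 4 + C (a : ℚ) * X ^ 3 - C (a : ℚ) * X + 1 with hf
  have := isGalois_splittingField f
  obtain ⟨e⟩ := nonempty_dihedralGroup_mulEquiv_of_quartic_splits ha ha' hf
    (SplittingField.splits f) fun g h hgh =>
      Gal.ext (p := f) fun x hx => hgh x (aeval_eq_zero_of_mem_rootSet hx)
  exact ⟨e.symm⟩
end

section
/- For all but finitely many integers a, the polynomial X⁴ + aX³ − 6X² − aX + 1 is irreducible over ℚ and the Galois group of its splitting field over ℚ is cyclic of order 4. -/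
open Polynomial

/-- The simplest quartic polynomial `X⁴ + aX³ − 6X² − aX + 1` over the integers. -/
noncomputable def simplestQuartic (a : ℤ) : ℤ[X] :=
  X ^ 4 + C a * X ^ 3 - C 6 * X ^ 2 - C a * X + 1

lemma simplestQuartic_natDegree (a : ℤ) : (simplestQuartic a).natDegree = 4 := by
  unfold simplestQuartic
  compute_degree!

lemma simplestQuartic_monic (a : ℤ) : (simplestQuartic a).Monic := by
  unfold simplestQuartic
  monicity!

lemma simplestQuartic_map (a : ℤ) :
    (simplestQuartic a).map (Int.castRingHom ℚ) =
      X ^ 4 + C (a : ℚ) * X ^ 3 - C (6 : ℚ) * X ^ 2 - C (a : ℚ) * X + 1 := by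
  simp [simplestQuartic, map_ofNat C 6]

lemma simplestQuartic_ne_linear_mul (a : ℤ) (f : ℤ[X]) (c : ℤ) :
    f * (X + C c) ≠ simplestQuartic a := by
  intro h
  have heval := congrArg (eval (-c)) h
  simp only [simplestQuartic, eval_mul, eval_add, eval_X, eval_C, eval_sub, eval_pow, eval_one,
    neg_add_cancel, mul_zero] at heval
  have hdvd : c ∣ 1 := ⟨-c ^ 3 + a * c ^ 2 + 6 * c - a, by linear_combination -heval⟩
  rcases Int.isUnit_iff.mp (isUnit_of_dvd_one hdvd) with rfl | rfl <;> ring_nf at heval <;> omega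

lemma simplestQuartic_ne_quadratic_mul {a : ℤ} (ha : 4 ≤ |a|) (p q r s : ℤ) :
    (X ^ 2 + C p * X + C q) * (X ^ 2 + C r * X + C s) ≠ simplestQuartic a := by
  intro h
  have hexpand : (X ^ 2 + C p * X + C q) * (X ^ 2 + C r * X + C s) =
      X ^ 4 + C (p + r) * X ^ 3 + C (q + s + p * r) * X ^ 2 + C (p * s + q * r) * X
        + C (q * s) := by
    simp only [C_add, C_mul]
    ring
  rw [hexpand, simplestQuartic] at h
  have h0 := congrArg (coeff · 0) h
  have h1 := congrArg (coeff · 1) h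
  have h2 := congrArg (coeff · 2) h
  have h3 := congrArg (coeff · 3) h
  simp only [coeff_add, coeff_sub, coeff_C_mul, coeff_X, coeff_C, coeff_one, coeff_X_pow]
    at h0 h1 h2 h3
  norm_num at h0 h1 h2 h3
  rcases Int.mul_eq_one_iff_eq_one_or_neg_one.mp h0 with ⟨rfl, rfl⟩ | ⟨rfl, rfl⟩
  · have : a = 0 := by omega
    simp [this] at ha
  · have hpr : p * r = -4 := by omega
    have hdvd : p ∣ 4 := ⟨-r, by linear_combination hpr⟩
    have hle := Int.le_of_dvd (by norm_num) hdvd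
    have hge := Int.le_of_dvd (by norm_num) (neg_dvd.mpr hdvd)
    have hp : -4 ≤ p := by omega
    interval_cases p <;> rcases le_abs'.mp ha with h | h <;> omega

lemma simplestQuartic_irreducible {a : ℤ} (ha : 4 ≤ |a|) :
    Irreducible (simplestQuartic a) := by
  have hm := simplestQuartic_monic a
  rw [hm.irreducible_iff_natDegree']
  refine ⟨fun h => by simpa [h] using simplestQuartic_natDegree a, fun f g hf hg hfg hdeg => ?_⟩
  have hsum := congrArg natDegree hfg
  rw [hf.natDegree_mul hg, simplestQuartic_natDegree] at hsum
  rw [simplestQuartic_natDegree, Finset.mem_Ioc] at hdeg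
  have quadratic : ∀ u : ℤ[X], u.Monic → u.natDegree = 2 →
      u = X ^ 2 + C (u.coeff 1) * X + C (u.coeff 0) := fun u hu hd => by
    conv_lhs => rw [hu.as_sum, hd]
    simp [Finset.sum_range_succ]
    ring
  obtain hd | hd : g.natDegree = 1 ∨ g.natDegree = 2 := by omega
  · rw [hg.eq_X_add_C hd] at hfg
    exact simplestQuartic_ne_linear_mul _ _ _ hfg
  · rw [quadratic f hf (by omega), quadratic g hg hd] at hfg
    exact simplestQuartic_ne_quadratic_mul ha _ _ _ _ hfg

lemma simplestQuartic_map_irreducible {a : ℤ} (ha : 4 ≤ |a|) :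
    Irreducible ((simplestQuartic a).map (Int.castRingHom ℚ)) :=
  (simplestQuartic_monic a).irreducible_iff_irreducible_map_fraction_map.mp
    (simplestQuartic_irreducible ha)

/-- The roots of the simplest quartic are the iterates of a root under
`x ↦ (x - 1) / (x + 1)`. -/
lemma eq_iterate_of_quartic_eq_zero {L : Type*} [Field L] {a x y : L} (h0 : x ≠ 0)
    (h1 : x + 1 ≠ 0) (h2 : 1 - x ≠ 0)
    (hx : x ^ 4 + a * x ^ 3 - 6 * x ^ 2 - a * x + 1 = 0)
    (hy : y ^ 4 + a * y ^ 3 - 6 * y ^ 2 - a * y + 1 = 0) :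
    y = x ∨ y = (x - 1) / (x + 1) ∨ y = -1 / x ∨ y = (x + 1) / (1 - x) := by
  have hprod :
      (y - x) * ((y * (x + 1) - (x - 1)) * ((y * x + 1) * (y * (1 - x) - (x + 1)))) = 0 := by
    linear_combination x * (x + 1) * (1 - x) * hy - y * (y + 1) * (1 - y) * hx
  rw [eq_div_iff h1, eq_div_iff h0, eq_div_iff h2]
  rcases mul_eq_zero.mp hprod with h | h
  · exact Or.inl (sub_eq_zero.mp h)
  rcases mul_eq_zero.mp h with h | h
  · exact Or.inr (Or.inl (sub_eq_zero.mp h))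
  rcases mul_eq_zero.mp h with h | h
  · exact Or.inr (Or.inr (Or.inl (eq_neg_of_add_eq_zero_left h)))
  · exact Or.inr (Or.inr (Or.inr (sub_eq_zero.mp h)))

/-- Over a field of characteristic zero, an irreducible simplest quartic has cyclic Galois group
of order four. -/
lemma isCyclic_and_card_gal_of_irreducible {K L : Type*} [Field K] [CharZero K] [Field L]
    [Algebra K L] {a : K} {P : K[X]} (hP : P = X ^ 4 + C a * X ^ 3 - C 6 * X ^ 2 - C a * X + 1)
    (hirr : Irreducible P) [IsSplittingField K L P] :
    IsCyclic Gal(L/K) ∧ Nat.card Gal(L/K) = 4 := by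
  have : CharZero L := charZero_of_injective_algebraMap (algebraMap K L).injective
  have := IsSplittingField.finiteDimensional L P
  have : IsGalois K L := IsGalois.of_separable_splitting_field hirr.separable
  have hmonic : P.Monic := by
    rw [hP]
    monicity!
  have hdeg : P.natDegree = 4 := by
    rw [hP]
    compute_degree!
  have haeval (x : L) : aeval x P =
      x ^ 4 + algebraMap K L a * x ^ 3 - 6 * x ^ 2 - algebraMap K L a * x + 1 := by
    simp only [hP, map_add, map_sub, map_mul, map_pow, aeval_X, aeval_C, map_ofNat, map_one]
  obtain ⟨x, hx⟩ : ∃ x : L, aeval x P = 0 := by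
    obtain ⟨x, hx⟩ := (IsSplittingField.splits L P).exists_eval_eq_zero (by
      rw [degree_map]; exact hirr.degree_pos.ne')
    exact ⟨x, by rwa [eval_map_algebraMap] at hx⟩
  have hmin : minpoly K x = P := (minpoly.eq_of_irreducible_of_monic hirr hx hmonic).symm
  have hxa := hx
  rw [haeval] at hxa
  have h0 : x ≠ 0 := by rintro rfl; simp at hxa
  have h1 : x + 1 ≠ 0 := fun h => by
    have : x = -1 := eq_neg_of_add_eq_zero_left h
    subst this
    ring_nf at hxa
    norm_num at hxa
  have h2 : 1 - x ≠ 0 := fun h => by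
    have : x = 1 := (sub_eq_zero.mp h).symm
    subst this
    ring_nf at hxa
    norm_num at hxa
  have htop : IntermediateField.adjoin K {x} = ⊤ := by
    have hmem := IntermediateField.mem_adjoin_simple_self K x
    have hone := one_mem (IntermediateField.adjoin K {x})
    rw [← IntermediateField.toSubalgebra_inj, IntermediateField.top_toSubalgebra, eq_top_iff,
      ← IsSplittingField.adjoin_rootSet L P, Algebra.adjoin_le_iff]
    intro y hy
    have hya := aeval_eq_zero_of_mem_rootSet hy
    rw [haeval] at hya
    rcases eq_iterate_of_quartic_eq_zero h0 h1 h2 hxa hya with rfl | rfl | rfl | rfl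
    · exact hmem
    · exact IntermediateField.div_mem _ (sub_mem hmem hone) (add_mem hmem hone)
    · exact IntermediateField.div_mem _ (neg_mem hone) hmem
    · exact IntermediateField.div_mem _ (add_mem hmem hone) (sub_mem hone hmem)
  have hcard : Nat.card Gal(L/K) = 4 := by
    have hfin := IntermediateField.adjoin.finrank (K := K) (Algebra.IsIntegral.isIntegral x)
    rw [htop, IntermediateField.finrank_top', hmin, hdeg] at hfin
    rw [IsGalois.card_aut_eq_finrank, hfin]
  refine ⟨?_, hcard⟩
  obtain ⟨σ, hσ⟩ : ∃ σ : Gal(L/K), σ x = (x - 1) / (x + 1) := by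
    refine minpoly.exists_algEquiv_of_root' (Algebra.IsAlgebraic.isAlgebraic x) ?_
    rw [hmin, haeval]
    field_simp
    linear_combination -4 * hxa
  have hσσ : σ (σ x) = -1 / x := by
    rw [hσ, map_div₀, map_sub, map_add, hσ, map_one]
    have hsub : (x - 1) / (x + 1) - 1 = -2 / (x + 1) := by
      field_simp
      ring
    have hadd : (x - 1) / (x + 1) + 1 = 2 * x / (x + 1) := by
      field_simp
      ring
    rw [hsub, hadd]
    field_simp
  have hsq : σ ^ 2 ≠ 1 := fun h => by
    have hfix : σ (σ x) = x := congrArg (fun τ : Gal(L/K) => τ x) ((sq σ).symm.trans h)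
    rw [hσσ, div_eq_iff h0] at hfix
    have hle : P.natDegree ≤ 2 := by
      rw [← hmin]
      calc (minpoly K x).natDegree ≤ (X ^ 2 + 1 : K[X]).natDegree :=
            natDegree_le_of_dvd (minpoly.dvd K x (by simp [sq, ← hfix]))
              (by apply Monic.ne_zero; monicity!)
        _ = 2 := by compute_degree!
    omega
  refine isCyclic_of_orderOf_eq_card σ ?_
  have hpow : σ ^ 2 ^ (1 + 1) = 1 := by
    have := pow_card_eq_one' (x := σ)
    rwa [hcard] at this
  rw [hcard, orderOf_eq_prime_pow (p := 2) (n := 1) (by simpa using hsq) hpow]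
  norm_num

/-- For all but finitely many integers `a`, the polynomial `X⁴ + aX³ − 6X² − aX + 1` is
irreducible over `ℚ` and the Galois group of its splitting field over `ℚ` is cyclic of
order `4`. -/
theorem simplest_quartic_galois_cyclic :
    {a : ℤ | ¬ (Irreducible (X ^ 4 + C (a : ℚ) * X ^ 3 - C (6 : ℚ) * X ^ 2 - C (a : ℚ) * X + 1) ∧
      IsCyclic (X ^ 4 + C (a : ℚ) * X ^ 3 - C (6 : ℚ) * X ^ 2 - C (a : ℚ) * X + 1).Gal ∧
      Nat.card (X ^ 4 + C (a : ℚ) * X ^ 3 - C (6 : ℚ) * X ^ 2 - C (a : ℚ) * X + 1).Gal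
        = 4)}.Finite := by
  refine (Set.finite_Ioo (-4 : ℤ) 4).subset fun a ha => ?_
  rw [Set.mem_Ioo, ← abs_lt]
  by_contra! h
  have hirr := simplestQuartic_map_irreducible h
  rw [simplestQuartic_map] at hirr
  exact ha ⟨hirr, isCyclic_and_card_gal_of_irreducible rfl hirr⟩
end

section
/- Let F be a number field with [F : ℚ] = 4 and let u ∈ F be such that ℚ(u) = F and both u and (u − 1)/(u + 1) are units of the ring of integers of F. Write the minimal polynomial of u over ℚ as X⁴ + aX³ + bX² + cX + ε with a, b, c ∈ ℤ and ε ∈ {1, −1}. Then a + c = 0 or b + ε + 1 = 0. -/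
open Polynomial IntermediateField

/-- The norm of `t - pb.gen`, for `t` in the base ring, is the value at `t` of the minimal polynomial
of `pb.gen`. -/
theorem PowerBasis.norm_algebraMap_sub_gen {K S : Type*} [Field K] [CommRing S]
    [Algebra K S] (pb : PowerBasis K S) (t : K) :
    Algebra.norm K (algebraMap K S t - pb.gen) = (minpoly K pb.gen).eval t := by
  rw [← charpoly_leftMulMatrix, Matrix.eval_charpoly, Algebra.norm_eq_matrix_det pb.basis, map_sub,
    AlgHom.commutes]
  rfl

/-- The norm of `t - x`, for `x` a primitive element of a finite extension of `K` and `t ∈ K`, is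
the value at `t` of the minimal polynomial of `x`. -/
theorem norm_algebraMap_sub_of_adjoin_eq_top {K L : Type*} [Field K] [Field L] [Algebra K L]
    {x : L} (hx : IsIntegral K x) (hgen : K⟮x⟯ = ⊤) (t : K) :
    Algebra.norm K (algebraMap K L t - x) = (minpoly K x).eval t := by
  have htop : Algebra.adjoin K {x} = ⊤ := by
    rw [← adjoin_simple_toSubalgebra_of_isAlgebraic hx.isAlgebraic, hgen, top_toSubalgebra]
  exact (PowerBasis.ofAdjoinEqTop hx htop).norm_algebraMap_sub_gen t

/-- A unit of the ring of integers of a number field has norm `1` or `-1`. -/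
theorem norm_eq_one_or_neg_one_of_unit {F : Type*} [Field F] [NumberField F]
    (w : (integralClosure ℤ F)ˣ) :
    Algebra.norm ℚ ((w : integralClosure ℤ F) : F) = 1 ∨
      Algebra.norm ℚ ((w : integralClosure ℤ F) : F) = -1 :=
  eq_or_eq_neg_of_abs_eq (NumberField.Units.norm (K := F) w)

/-- Let `F` be a number field of degree `4` over `ℚ` and let `u ∈ F` be such that
`ℚ(u) = F` and both `u` and `(u − 1)/(u + 1)` are units of the ring of integers of `F`
(the integral closure of `ℤ` in `F`). Write the minimal polynomial of `u` over `ℚ` as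
`X⁴ + aX³ + bX² + cX + ε` with `a, b, c ∈ ℤ` and `ε ∈ {1, -1}`. Then `a + c = 0` or
`b + ε + 1 = 0`. -/
theorem quartic_field_unit_minpoly_coeffs (F : Type*) [Field F] [NumberField F]
    (hdeg : Module.finrank ℚ F = 4) (u : F) (hgen : ℚ⟮u⟯ = (⊤ : IntermediateField ℚ F))
    (hu : ∃ w : (integralClosure ℤ F)ˣ, ((w : integralClosure ℤ F) : F) = u)
    (hu' : ∃ w : (integralClosure ℤ F)ˣ, ((w : integralClosure ℤ F) : F) = (u - 1) / (u + 1))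
    (a b c ε : ℤ) (hε : ε = 1 ∨ ε = -1)
    (hmin : minpoly ℚ u = X ^ 4 + C (a : ℚ) * X ^ 3 + C (b : ℚ) * X ^ 2 + C (c : ℚ) * X
      + C (ε : ℚ)) :
    a + c = 0 ∨ b + ε + 1 = 0 := by
  obtain ⟨w, hw⟩ := hu'
  have hw0 : (u - 1) / (u + 1) ≠ 0 := by
    rw [← hw]
    simp
  have hden : u + 1 ≠ 0 := (div_ne_zero_iff.mp hw0).2
  have hint : IsIntegral ℚ u := Algebra.IsIntegral.isIntegral u
  have h1 := norm_algebraMap_sub_of_adjoin_eq_top hint hgen 1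
  have h2 := norm_algebraMap_sub_of_adjoin_eq_top hint hgen (-1)
  have hmul : algebraMap ℚ F 1 - u = (u - 1) / (u + 1) * (algebraMap ℚ F (-1) - u) := by
    simp only [map_one, map_neg]
    field_simp
    ring
  rw [hmul, map_mul, h2, ← hw, hmin] at h1
  simp only [eval_add, eval_mul, eval_pow, eval_X, eval_C] at h1
  rcases norm_eq_one_or_neg_one_of_unit w with h | h <;> rw [h] at h1
  · left
    have : (a + c : ℚ) = 0 := by linarith
    exact_mod_cast this
  · right
    have : (b + ε + 1 : ℚ) = 0 := by linarith
    exact_mod_cast this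
end

section
/- For every integer a with |a| ≥ 3, every complex root of the polynomial X⁴ + aX³ − aX + 1 is real. -/
/-- A quadratic `X² - wX - 1` with `w` real has only real roots. -/
theorem im_eq_zero_of_sq_sub_mul_sub_one_eq_zero {w : ℝ} {z : ℂ}
    (h : z ^ 2 - (w : ℂ) * z - 1 = 0) : z.im = 0 := by
  have hre := congrArg Complex.re h
  have him := congrArg Complex.im h
  simp [pow_two] at hre him
  by_contra hy
  have hw : w = 2 * z.re := mul_right_cancel₀ hy (by linarith)
  subst hw
  nlinarith [sq_nonneg z.re, sq_nonneg z.im]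

/-- For every integer `a` with `|a| ≥ 3`, every complex root of the polynomial
`X⁴ + aX³ − aX + 1` is real. -/
theorem quartic_family_all_roots_real (a : ℤ) (ha : 3 ≤ |a|) (z : ℂ)
    (hz : z ^ 4 + (a : ℂ) * z ^ 3 - (a : ℂ) * z + 1 = 0) :
    z.im = 0 := by
  have ha' : (0 : ℝ) ≤ (a : ℝ) ^ 2 - 8 := by
    have : 0 ≤ a ^ 2 - 8 := by nlinarith [sq_abs a]
    exact_mod_cast this
  obtain ⟨s, hs⟩ : ∃ s : ℝ, s ^ 2 = (a : ℝ) ^ 2 - 8 := ⟨_, Real.sq_sqrt ha'⟩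
  have hs' : (s : ℂ) ^ 2 = (a : ℂ) ^ 2 - 8 := by exact_mod_cast congrArg Complex.ofReal hs
  have hfactor : (z ^ 2 - (((-a + s) / 2 : ℝ) : ℂ) * z - 1) *
      (z ^ 2 - (((-a - s) / 2 : ℝ) : ℂ) * z - 1) = 0 := by
    push_cast
    linear_combination hz - z ^ 2 / 4 * hs'
  exact (mul_eq_zero.mp hfactor).elim im_eq_zero_of_sq_sub_mul_sub_one_eq_zero
    im_eq_zero_of_sq_sub_mul_sub_one_eq_zero
end
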